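/- arXiv:1803.10832 — 2 statements merged into one kernel-verified Lean document; each statement's English description precedes it below -/
import Mathlib

section
/- Let α > 0 be a non-integer real number whose integer part is an even positive integer 2p, and set α' := α − 2p ∈ (0,1). Let ψ : (0,1) → ℝ be locally Lipschitz on (0,1) and belong to L¹_{1−α'}((0,1)). Define y₀(x) := (1/(2^{α'} Γ(α'))) ∫₀^x (x−t)^{α'−1} ψ(t) dt for x ∈ [0,1], and y(x) := (−1)^p ∫₀^1 G_p(x,t) y₀(t) dt. Then: (i) y is 2p times differentiable on (0,1) and p−1 times differentiable at 0 and 1 with y^{(j)}(0) = y^{(j)}(1) = 0 for 0 ≤ j ≤ p−1; (ii) y^{(2p)}(x) = y₀(x) for every x ∈ (0,1); and (iii) for every x ∈ (0,1), (2^{α'}/Γ(−α')) · ( ∫₀^x (x−t)^{−α'−1} (y^{(2p)}(t) − y^{(2p)}(x)) dt − y^{(2p)}(x) · x^{−α'}/α' ) = ψ(x). Thus y solves D_α(y) = ψ on (0,1) with the 2p Dirichlet-type boundary conditions. -/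
open MeasureTheory Filter

/-- `g` is locally Lipschitz (locally contracting) on `(0,1)`. -/
def LocLip01 (g : ℝ → ℝ) : Prop :=
  ∀ a b : ℝ, 0 < a → a ≤ b → b < 1 →
    ∃ K : ℝ, ∀ z ∈ Set.Icc a b, ∀ z' ∈ Set.Icc a b, |g z - g z'| ≤ K * |z - z'|

/-- `g` belongs to the class `L¹_{1-α'}((0,1))`. -/
def MemL1Class (α' : ℝ) (g : ℝ → ℝ) : Prop :=
  ∃ γ : ℝ, 0 ≤ γ ∧ γ ≤ 1 - α' ∧
    (g =O[nhdsWithin 0 (Set.Ioi 0)] fun t : ℝ => t ^ (-γ)) ∧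
    ((fun t : ℝ => g (1 - t)) =O[nhdsWithin 0 (Set.Ioi 0)] fun t : ℝ => t ^ (-γ))

/-- The Green kernel `G_p`. -/
noncomputable def GreenK (p : ℕ) (x y : ℝ) : ℝ :=
  if x = 0 ∧ y = 0 then 0
  else
    x ^ p * y ^ p / ((Nat.factorial (p - 1) : ℝ)) ^ 2 *
      ∫ t in (max x y)..1, (t - x) ^ (p - 1) * (t - y) ^ (p - 1) / t ^ (2 * p)

/-- The fractional primitive of order `α' ∈ (0,1)`. -/
noncomputable def Jfrac (α' : ℝ) (ψ : ℝ → ℝ) (x : ℝ) : ℝ :=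
  1 / ((2 : ℝ) ^ α' * Real.Gamma α') * ∫ t in (0 : ℝ)..x, (x - t) ^ (α' - 1) * ψ t

/-- The Green-kernel primitive of order `2p` with Dirichlet-type boundary conditions. -/
noncomputable def Jgreen (p : ℕ) (g : ℝ → ℝ) (x : ℝ) : ℝ :=
  (-1 : ℝ) ^ p * ∫ t in (0 : ℝ)..1, GreenK p x t * g t

/-- The `(n+1)`-fold iterated primitive of `f` based at `a`, given by Cauchy's formula. -/
noncomputable def cauchyPrim (n : ℕ) (f : ℝ → ℝ) (a x : ℝ) : ℝ :=
  ∫ s in a..x, (x - s) ^ n / (Nat.factorial n : ℝ) * f s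

lemma cauchyPrim_self (n : ℕ) (f : ℝ → ℝ) (a : ℝ) : cauchyPrim n f a a = 0 := by
  simp [cauchyPrim]

lemma hasDerivAt_cauchyPrim_succ {f : ℝ → ℝ} (hf : ∀ a b, IntervalIntegrable f volume a b)
    (n : ℕ) (a x : ℝ) :
    HasDerivAt (cauchyPrim (n + 1) f a) (cauchyPrim n f a x) x := by
  have hker : ∀ (m : ℕ) (y c d : ℝ), IntervalIntegrable
      (fun s => (y - s) ^ m / (Nat.factorial m : ℝ) * f s) volume c d := fun m y c d =>
    (hf c d).continuousOn_mul (by fun_prop)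
  have hsplit : cauchyPrim (n + 1) f a = fun y =>
      (∫ s in a..x, (y - s) ^ (n + 1) / (Nat.factorial (n + 1) : ℝ) * f s) +
        ∫ s in x..y, (y - s) ^ (n + 1) / (Nat.factorial (n + 1) : ℝ) * f s := by
    funext y
    rw [cauchyPrim, intervalIntegral.integral_add_adjacent_intervals (hker _ _ _ _)
      (hker _ _ _ _)]
  have hP : HasDerivAt
      (fun y => ∫ s in a..x, (y - s) ^ (n + 1) / (Nat.factorial (n + 1) : ℝ) * f s)
      (∫ s in a..x, (x - s) ^ n / (Nat.factorial n : ℝ) * f s) x := by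
    have hcomp : IsCompact (Metric.closedBall x 1 ×ˢ Set.uIcc a x) :=
      (isCompact_closedBall x 1).prod isCompact_uIcc
    obtain ⟨C, hC⟩ := hcomp.exists_bound_of_continuousOn
      (f := fun q : ℝ × ℝ => (q.1 - q.2) ^ n / (Nat.factorial n : ℝ)) (by fun_prop)
    refine (intervalIntegral.hasDerivAt_integral_of_dominated_loc_of_deriv_le
      (F' := fun y s => (y - s) ^ n / (Nat.factorial n : ℝ) * f s)
      (bound := fun s => C * ‖f s‖) (s := Metric.closedBall x 1)
      (Metric.closedBall_mem_nhds x one_pos) ?_ (hker _ _ _ _) ?_ ?_ ?_ ?_).2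
    · exact Eventually.of_forall fun y => IntervalIntegrable.aestronglyMeasurable_restrict_uIoc (hker _ _ _ _)
    · exact IntervalIntegrable.aestronglyMeasurable_restrict_uIoc (hker _ _ _ _)
    · refine ae_of_all _ fun s hs y hy => ?_
      rw [norm_mul]
      exact mul_le_mul_of_nonneg_right (hC (y, s) ⟨hy, Set.uIoc_subset_uIcc hs⟩) (norm_nonneg _)
    · exact (hf a x).norm.const_mul C
    · refine ae_of_all _ fun s _ y _ => ?_
      have h := ((((hasDerivAt_id y).sub_const s).pow (n + 1)).div_const
        (Nat.factorial (n + 1) : ℝ)).mul_const (f s)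
      refine HasDerivAt.congr_deriv h ?_
      have : (Nat.factorial n : ℝ) ≠ 0 := by positivity
      rw [Nat.factorial_succ, Nat.cast_mul]
      simp only [id, Nat.add_sub_cancel]
      field_simp
  have hE : HasDerivAt
      (fun y => ∫ s in x..y, (y - s) ^ (n + 1) / (Nat.factorial (n + 1) : ℝ) * f s) 0 x := by
    rw [hasDerivAt_iff_isLittleO]
    simp only [intervalIntegral.integral_same, sub_zero, smul_zero]
    have hcont : Tendsto (fun y => ∫ s in x..y, ‖f s‖) (nhds x) (nhds 0) := by
      have h := (intervalIntegral.continuous_primitive (fun c d => (hf c d).norm) x).tendsto x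
      simpa using h
    have hbig : (fun y => ∫ s in x..y, (y - s) ^ (n + 1) / (Nat.factorial (n + 1) : ℝ) * f s)
        =O[nhds x] fun y => (y - x) * ∫ s in x..y, ‖f s‖ := by
      refine Asymptotics.IsBigO.of_bound 1 ?_
      filter_upwards [Metric.closedBall_mem_nhds x one_pos] with y hy
      rw [one_mul, norm_mul]
      have hyx : |y - x| ≤ 1 := by simpa [Real.dist_eq] using hy
      have h1 : ∀ s ∈ Set.uIoc x y,
          ‖(y - s) ^ (n + 1) / (Nat.factorial (n + 1) : ℝ) * f s‖ ≤ |y - x| * ‖f s‖ := by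
        intro s hs
        rw [norm_mul]
        refine mul_le_mul_of_nonneg_right ?_ (norm_nonneg _)
        have h2 : |y - s| ≤ |y - x| :=
          Set.abs_sub_right_of_mem_uIcc (Set.uIoc_subset_uIcc hs)
        have h3 : (1 : ℝ) ≤ (Nat.factorial (n + 1) : ℝ) := by
          exact_mod_cast Nat.one_le_iff_ne_zero.mpr (Nat.factorial_ne_zero _)
        rw [norm_div, norm_pow, Real.norm_eq_abs, Real.norm_eq_abs, Nat.abs_cast]
        calc |y - s| ^ (n + 1) / (Nat.factorial (n + 1) : ℝ) ≤ |y - s| ^ (n + 1) :=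
              div_le_self (by positivity) h3
          _ ≤ |y - s| ^ 1 := pow_le_pow_of_le_one (abs_nonneg _) (h2.trans hyx) (by omega)
          _ ≤ |y - x| := by simpa using h2
      have h4 := intervalIntegral.norm_integral_le_abs_of_norm_le
        (μ := volume) (a := x) (b := y)
        (f := fun s => (y - s) ^ (n + 1) / (Nat.factorial (n + 1) : ℝ) * f s)
        (g := fun s => |y - x| * ‖f s‖) (ae_restrict_of_forall_mem measurableSet_uIoc h1) ((hf x y).norm.const_mul _)
      refine h4.trans (le_of_eq ?_)
      rw [intervalIntegral.integral_const_mul, abs_mul, abs_abs]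
      rfl
    refine hbig.trans_isLittleO ?_
    have := (Asymptotics.isBigO_refl (fun y => y - x) (nhds x)).mul_isLittleO
      ((Asymptotics.isLittleO_one_iff ℝ).2 hcont)
    simpa using this
  rw [hsplit]
  have h := hP.add hE
  rw [add_zero] at h
  exact h

lemma deriv_cauchyPrim_succ {f : ℝ → ℝ} (hf : ∀ a b, IntervalIntegrable f volume a b)
    (n : ℕ) (a : ℝ) : deriv (cauchyPrim (n + 1) f a) = cauchyPrim n f a :=
  funext fun x => (hasDerivAt_cauchyPrim_succ hf n a x).deriv

lemma cauchyPrim_zero (f : ℝ → ℝ) (a : ℝ) : cauchyPrim 0 f a = fun x => ∫ s in a..x, f s := by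
  funext x; simp [cauchyPrim]

lemma contDiff_cauchyPrim {f : ℝ → ℝ} (hf : ∀ a b, IntervalIntegrable f volume a b)
    (n : ℕ) (a : ℝ) : ContDiff ℝ n (cauchyPrim n f a) := by
  induction n with
  | zero =>
    rw [cauchyPrim_zero]
    exact contDiff_zero.2 (intervalIntegral.continuous_primitive hf a)
  | succ n ih =>
    push_cast
    rw [contDiff_succ_iff_deriv, deriv_cauchyPrim_succ hf]
    exact ⟨fun x => (hasDerivAt_cauchyPrim_succ hf n a x).differentiableAt, by simp, ih⟩

lemma iteratedDeriv_cauchyPrim {f : ℝ → ℝ} (hf : ∀ a b, IntervalIntegrable f volume a b)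
    (k n : ℕ) (a : ℝ) : iteratedDeriv k (cauchyPrim (n + k) f a) = cauchyPrim n f a := by
  induction k with
  | zero => simp
  | succ k ih => rw [iteratedDeriv_succ', ← add_assoc, deriv_cauchyPrim_succ hf, ih]

lemma deriv_cauchyPrim_zero {f : ℝ → ℝ} (hf : ∀ a b, IntervalIntegrable f volume a b)
    {U : Set ℝ} (hU : IsOpen U) (hc : ContinuousOn f U) (a : ℝ) {x : ℝ} (hx : x ∈ U) :
    HasDerivAt (cauchyPrim 0 f a) (f x) x := by
  rw [cauchyPrim_zero]
  refine intervalIntegral.integral_hasDerivAt_right (hf a x) ?_ (hc.continuousAt (hU.mem_nhds hx))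
  exact hc.stronglyMeasurableAtFilter hU x hx

lemma iteratedDeriv_succ_cauchyPrim {f : ℝ → ℝ} (hf : ∀ a b, IntervalIntegrable f volume a b)
    {U : Set ℝ} (hU : IsOpen U) (hc : ContinuousOn f U) (n : ℕ) (a : ℝ) {x : ℝ} (hx : x ∈ U) :
    iteratedDeriv (n + 1) (cauchyPrim n f a) x = f x := by
  have h := iteratedDeriv_cauchyPrim hf n 0 a
  rw [zero_add] at h
  rw [iteratedDeriv_succ, h, (deriv_cauchyPrim_zero hf hU hc a hx).deriv]

lemma contDiffOn_cauchyPrim {f : ℝ → ℝ} (hf : ∀ a b, IntervalIntegrable f volume a b)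
    {U : Set ℝ} (hU : IsOpen U) {m : ℕ} (hc : ContDiffOn ℝ m f U) (n : ℕ) (a : ℝ) :
    ContDiffOn ℝ (m + n + 1 : ℕ) (cauchyPrim n f a) U := by
  induction n with
  | zero =>
    push_cast
    rw [contDiffOn_succ_iff_deriv_of_isOpen hU]
    refine ⟨fun x hx => (deriv_cauchyPrim_zero hf hU hc.continuousOn a
      hx).differentiableAt.differentiableWithinAt, by simp, ?_⟩
    simpa using hc.congr fun x hx => (deriv_cauchyPrim_zero hf hU hc.continuousOn a hx).deriv
  | succ n ih =>
    have : ((m + (n + 1) + 1 : ℕ) : WithTop ℕ∞) = ((m + n + 1 : ℕ) : WithTop ℕ∞) + 1 := by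
      push_cast; ring
    rw [this, contDiffOn_succ_iff_deriv_of_isOpen hU, deriv_cauchyPrim_succ hf]
    exact ⟨fun x _ =>
      (hasDerivAt_cauchyPrim_succ hf n a x).differentiableAt.differentiableWithinAt, by simp, ih⟩

lemma contDiffAt_iteratedDeriv {f : ℝ → ℝ} {x : ℝ} {n k : ℕ}
    (hf : ContDiffAt ℝ (n + k : ℕ) f x) : ContDiffAt ℝ n (iteratedDeriv k f) x := by
  have h : ContDiffAt ℝ n (iteratedFDeriv ℝ k f) x :=
    hf.iteratedFDeriv_right (i := k) (by norm_cast)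
  exact (ContinuousMultilinearMap.apply ℝ (fun _ : Fin k => ℝ) ℝ
    (fun _ => (1 : ℝ))).contDiff.contDiffAt.comp x h

/-- The operator identity `D^(2p) (x^p u) = x^(-p) D^p (x^(2p) D^p u)`. -/
lemma iteratedDeriv_pow_mul_eq {u : ℝ → ℝ} {x : ℝ} (p : ℕ)
    (hu : ContDiffAt ℝ (2 * p : ℕ) u x) :
    x ^ p * iteratedDeriv (2 * p) (fun z => z ^ p * u z) x =
      iteratedDeriv p (fun z => z ^ (2 * p) * iteratedDeriv p u z) x := by
  have hu' : ContDiffAt ℝ p (iteratedDeriv p u) x := by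
    refine contDiffAt_iteratedDeriv (n := p) (k := p) ?_
    rwa [← two_mul]
  have hpow : ∀ m n : ℕ, ContDiffAt ℝ n (fun z : ℝ => z ^ m) x := fun m n =>
    (contDiff_id.pow m).contDiffAt
  rw [iteratedDeriv_fun_mul (hpow p _) hu, iteratedDeriv_fun_mul (hpow (2 * p) _) hu']
  have hsub : ∑ i ∈ Finset.range (2 * p + 1), ((2 * p).choose i : ℝ) *
      iteratedDeriv i (fun z : ℝ => z ^ p) x * iteratedDeriv (2 * p - i) u x =
      ∑ i ∈ Finset.range (p + 1), ((2 * p).choose i : ℝ) *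
      iteratedDeriv i (fun z : ℝ => z ^ p) x * iteratedDeriv (2 * p - i) u x := by
    symm
    refine Finset.sum_subset (Finset.range_mono (by omega)) fun i _ hi => ?_
    have hpi : p < i := by simpa using hi
    simp [iteratedDeriv_pow, Nat.descFactorial_of_lt hpi]
  rw [hsub, Finset.mul_sum]
  refine Finset.sum_congr rfl fun i hi => ?_
  have hip : i ≤ p := by simpa [Nat.lt_succ_iff] using hi
  have hiter : iteratedDeriv (p - i) (iteratedDeriv p u) x = iteratedDeriv (2 * p - i) u x := by
    rw [iteratedDeriv_eq_iterate, iteratedDeriv_eq_iterate, iteratedDeriv_eq_iterate,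
      ← Function.iterate_add_apply, show p - i + p = 2 * p - i by omega]
  have hcoef : (2 * p).choose i * p.descFactorial i = p.choose i * (2 * p).descFactorial i := by
    rw [Nat.descFactorial_eq_factorial_mul_choose, Nat.descFactorial_eq_factorial_mul_choose]
    ring
  have hcoef' : ((2 * p).choose i : ℝ) * p.descFactorial i =
      p.choose i * (2 * p).descFactorial i := by exact_mod_cast hcoef
  rw [hiter, iteratedDeriv_pow, iteratedDeriv_pow,
    show 2 * p - i = p + (p - i) by omega, pow_add]
  linear_combination x ^ p * x ^ (p - i) * iteratedDeriv (p + (p - i)) u x * hcoef'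

/-- The integrand of the Green primitive before the factor `(s - x) ^ (p - 1)` is inserted. -/
noncomputable def greenIntegrand (n : ℕ) (g : ℝ → ℝ) (t s : ℝ) : ℝ :=
  if t < s then (s - t) ^ n / (Nat.factorial n : ℝ) / s ^ (2 * (n + 1)) * (t ^ (n + 1) * g t)
  else 0

/-- The function `t ^ (n + 1) * g t` on `(0,1)`, extended by zero. -/
noncomputable def greenWeight (n : ℕ) (g : ℝ → ℝ) : ℝ → ℝ :=
  Set.indicator (Set.Ioo 0 1) fun t => t ^ (n + 1) * g t

/-- The density whose iterated primitive is the Green primitive divided by `x ^ p`. -/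
noncomputable def greenDensity (n : ℕ) (g : ℝ → ℝ) (s : ℝ) : ℝ :=
  cauchyPrim n (greenWeight n g) 0 s / s ^ (2 * (n + 1))

lemma aestronglyMeasurable_greenIntegrand {n : ℕ} {g : ℝ → ℝ}
    (hg : IntegrableOn g (Set.Ioo 0 1)) :
    AEStronglyMeasurable (Function.uncurry (greenIntegrand n g))
      ((volume.restrict (Set.Ioo (0 : ℝ) 1)).prod (volume.restrict (Set.Ioi (0 : ℝ)))) := by
  have hset : MeasurableSet {q : ℝ × ℝ | q.1 < q.2} := measurableSet_lt measurable_fst measurable_snd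
  have h1 : Measurable fun q : ℝ × ℝ =>
      (q.2 - q.1) ^ n / (Nat.factorial n : ℝ) / q.2 ^ (2 * (n + 1)) := by fun_prop
  have h2 : Measurable fun q : ℝ × ℝ => q.1 ^ (n + 1) := by fun_prop
  have h := (h1.aestronglyMeasurable.mul (h2.aestronglyMeasurable.mul
    (hg.aestronglyMeasurable.comp_fst (ν := volume.restrict (Set.Ioi (0 : ℝ)))))).indicator hset
  refine h.congr (ae_of_all _ fun q => ?_)
  simp [Function.uncurry, greenIntegrand, Set.indicator_apply]

lemma norm_greenIntegrand_le {n : ℕ} {g : ℝ → ℝ} {t s : ℝ} (ht : 0 < t) :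
    ‖greenIntegrand n g t s‖ ≤
      Set.indicator (Set.Ioi t) (fun s => s ^ (-(n + 2 : ℝ))) s * (t ^ (n + 1) * ‖g t‖) := by
  rw [greenIntegrand]
  split_ifs with h
  · have hs : 0 < s := ht.trans h
    rw [Set.indicator_of_mem (show s ∈ Set.Ioi t from h), norm_mul, norm_mul (t ^ (n + 1)),
      Real.norm_of_nonneg (pow_nonneg ht.le _)]
    refine mul_le_mul_of_nonneg_right ?_ (by positivity)
    have h1 : (1 : ℝ) ≤ (Nat.factorial n : ℝ) := by
      exact_mod_cast Nat.one_le_iff_ne_zero.mpr (Nat.factorial_ne_zero _)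
    have hst : 0 ≤ s - t := by linarith
    rw [Real.norm_of_nonneg (by positivity), div_le_iff₀ (by positivity)]
    calc (s - t) ^ n / (Nat.factorial n : ℝ) ≤ (s - t) ^ n := div_le_self (by positivity) h1
      _ ≤ s ^ n := by gcongr; linarith
      _ = s ^ (-(n + 2 : ℝ)) * s ^ (2 * (n + 1)) := by
        rw [← Real.rpow_natCast, ← Real.rpow_natCast, ← Real.rpow_add hs]
        congr 1; push_cast; ring
  · rw [norm_zero]
    refine mul_nonneg (Set.indicator_nonneg (fun s hs => ?_) _) (by positivity)
    exact Real.rpow_nonneg (ht.le.trans (le_of_lt hs)) _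

lemma integrable_greenIntegrand (n : ℕ) {g : ℝ → ℝ} (hg : IntegrableOn g (Set.Ioo 0 1)) :
    Integrable (Function.uncurry (greenIntegrand n g))
      ((volume.restrict (Set.Ioo (0 : ℝ) 1)).prod (volume.restrict (Set.Ioi (0 : ℝ)))) := by
  have hmeas := aestronglyMeasurable_greenIntegrand (n := n) hg
  have hlt : (-(n + 2 : ℝ)) < -1 := by
    have : (0 : ℝ) ≤ n := n.cast_nonneg
    linarith
  have hdom : ∀ t ∈ Set.Ioo (0 : ℝ) 1, Integrable (fun s => Set.indicator (Set.Ioi t)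
      (fun s => s ^ (-(n + 2 : ℝ))) s * (t ^ (n + 1) * ‖g t‖))
      (volume.restrict (Set.Ioi (0 : ℝ))) := fun t ht => by
    refine Integrable.mul_const ?_ _
    exact ((integrable_indicator_iff measurableSet_Ioi).2
      (integrableOn_Ioi_rpow_of_lt hlt ht.1)).restrict
  have hint : ∀ t ∈ Set.Ioo (0 : ℝ) 1, Integrable (fun s => greenIntegrand n g t s)
      (volume.restrict (Set.Ioi (0 : ℝ))) := fun t ht => by
    refine (hdom t ht).mono' ?_ (ae_of_all _ fun s => norm_greenIntegrand_le ht.1)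
    have : Measurable fun s => greenIntegrand n g t s :=
      Measurable.ite measurableSet_Ioi (by fun_prop) measurable_const
    exact this.aestronglyMeasurable
  rw [integrable_prod_iff hmeas]
  refine ⟨ae_restrict_of_forall_mem measurableSet_Ioo hint, ?_⟩
  refine (hg.norm.div_const (n + 1 : ℝ)).mono' hmeas.norm.integral_prod_right'
    (ae_restrict_of_forall_mem measurableSet_Ioo fun t ht => ?_)
  rw [Real.norm_of_nonneg (integral_nonneg fun _ => norm_nonneg _)]
  refine (integral_mono (hint t ht).norm (hdom t ht)
    fun s => norm_greenIntegrand_le ht.1).trans (le_of_eq ?_)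
  have ht0 := ht.1
  rw [integral_mul_const, setIntegral_indicator measurableSet_Ioi,
    Set.inter_eq_right.2 (Set.Ioi_subset_Ioi ht.1.le), integral_Ioi_rpow_of_lt hlt ht.1,
    show (-(n + 2 : ℝ)) + 1 = -(n + 1 : ℝ) by ring, Real.rpow_neg ht.1.le,
    show (n + 1 : ℝ) = ((n + 1 : ℕ) : ℝ) by push_cast; ring, Real.rpow_natCast]
  field_simp

lemma integrable_greenWeight (n : ℕ) {g : ℝ → ℝ} (hg : IntegrableOn g (Set.Ioo 0 1)) :
    Integrable (greenWeight n g) := by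
  refine (integrable_indicator_iff measurableSet_Ioo).2 ?_
  refine Integrable.bdd_mul (c := 1) hg (by fun_prop) ?_
  refine ae_restrict_of_forall_mem measurableSet_Ioo fun t ht => ?_
  rw [norm_pow, Real.norm_of_nonneg ht.1.le]
  exact pow_le_one₀ ht.1.le ht.2.le

lemma cauchyPrim_greenWeight_of_nonpos (n : ℕ) (g : ℝ → ℝ) {s : ℝ} (hs : s ≤ 0) :
    cauchyPrim n (greenWeight n g) 0 s = 0 := by
  rw [cauchyPrim, intervalIntegral.integral_symm, intervalIntegral.integral_of_le hs,
    setIntegral_eq_zero_of_forall_eq_zero, neg_zero]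
  intro t ht
  have : t ∉ Set.Ioo (0 : ℝ) 1 := fun h => absurd h.1 (not_lt.2 ht.2)
  simp [greenWeight, this]

lemma greenDensity_of_nonpos (n : ℕ) (g : ℝ → ℝ) {s : ℝ} (hs : s ≤ 0) :
    greenDensity n g s = 0 := by
  rw [greenDensity, cauchyPrim_greenWeight_of_nonpos n g hs, zero_div]

lemma integral_greenIntegrand (n : ℕ) (g : ℝ → ℝ) {s : ℝ} (hs : 0 < s) :
    ∫ t in Set.Ioo (0 : ℝ) 1, greenIntegrand n g t s = greenDensity n g s := by
  rw [greenDensity, cauchyPrim, intervalIntegral.integral_of_le hs.le, integral_Ioc_eq_integral_Ioo,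
    ← integral_div, ← integral_indicator measurableSet_Ioo, ← integral_indicator measurableSet_Ioo]
  refine integral_congr_ae (ae_of_all _ fun t => ?_)
  by_cases h1 : t ∈ Set.Ioo (0 : ℝ) 1 <;> by_cases h2 : t < s
  · have h3 : t ∈ Set.Ioo 0 s := ⟨h1.1, h2⟩
    simp only [Set.indicator_of_mem h1, Set.indicator_of_mem h3, greenIntegrand, if_pos h2,
      greenWeight]
    ring
  · have h3 : t ∉ Set.Ioo 0 s := fun h => h2 h.2
    simp only [Set.indicator_of_mem h1, Set.indicator_of_notMem h3, greenIntegrand, if_neg h2]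
  · simp only [Set.indicator_of_notMem h1, Set.indicator_apply, greenWeight, if_neg h1, mul_zero,
      zero_div, ite_self]
  · simp only [Set.indicator_of_notMem h1, Set.indicator_apply, greenWeight, if_neg h1, mul_zero,
      zero_div, ite_self]

lemma integrable_greenDensity (n : ℕ) {g : ℝ → ℝ} (hg : IntegrableOn g (Set.Ioo 0 1)) :
    Integrable (greenDensity n g) := by
  have h : IntegrableOn (greenDensity n g) (Set.Ioi 0) :=
    (integrable_greenIntegrand n hg).integral_prod_right.congr
      (ae_restrict_of_forall_mem measurableSet_Ioi fun s hs => integral_greenIntegrand n g hs)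
  have h2 : greenDensity n g = Set.indicator (Set.Ioi 0) (greenDensity n g) := by
    funext s
    by_cases hs : 0 < s
    · rw [Set.indicator_of_mem (show s ∈ Set.Ioi 0 from hs)]
    · rw [Set.indicator_of_notMem (show s ∉ Set.Ioi 0 from hs),
        greenDensity_of_nonpos n g (not_lt.1 hs)]
  rw [h2]
  exact (integrable_indicator_iff measurableSet_Ioi).2 h

lemma greenK_mul_eq (n : ℕ) (g : ℝ → ℝ) (x : ℝ) {t : ℝ} (ht : t ∈ Set.Ioo (0 : ℝ) 1) :
    GreenK (n + 1) x t * g t = x ^ (n + 1) / (Nat.factorial n : ℝ) * (if x ≤ 1 then 1 else -1) *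
      ∫ s in Set.Ioi (0 : ℝ), Set.indicator (Set.uIoc (max x 0) 1) (fun s => (s - x) ^ n) s *
        greenIntegrand n g t s := by
  have hcond : ¬ (x = 0 ∧ t = 0) := fun h => ht.1.ne' h.2
  have hsgn : (max x t ≤ 1) = (x ≤ 1) := by simp [ht.2.le]
  have hset : Set.uIoc (max x t) 1 = Set.Ioi 0 ∩ (Set.uIoc (max x 0) 1 ∩ Set.Ioi t) := by
    obtain ⟨h0, h1⟩ := ht
    ext s
    simp only [Set.mem_uIoc, Set.mem_inter_iff, Set.mem_Ioi]
    rcases le_total x 1 with hx | hx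
    · constructor
      · rintro (⟨h2, h3⟩ | ⟨h2, h3⟩)
        · have h4 := (max_lt_iff.1 h2)
          exact ⟨h0.trans h4.2, Or.inl ⟨max_lt h4.1 (h0.trans h4.2), h3⟩, h4.2⟩
        · have := h3.trans (max_le hx h1.le); linarith
      · rintro ⟨h2, (⟨h3, h4⟩ | ⟨h3, h4⟩), h5⟩
        · exact Or.inl ⟨max_lt (max_lt_iff.1 h3).1 h5, h4⟩
        · have := h4.trans (max_le hx zero_le_one); linarith
    · rw [max_eq_left (h1.le.trans hx), max_eq_left (zero_le_one.trans hx)]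
      constructor
      · rintro (⟨h2, h3⟩ | ⟨h2, h3⟩)
        · linarith
        · exact ⟨by linarith, Or.inr ⟨h2, h3⟩, by linarith⟩
      · rintro ⟨-, h, -⟩
        exact h
  rw [GreenK, if_neg hcond, intervalIntegral.intervalIntegral_eq_integral_uIoc]
  simp only [hsgn, Nat.add_sub_cancel]
  have hint : ∫ s in Set.Ioi (0 : ℝ), Set.indicator (Set.uIoc (max x 0) 1)
      (fun s => (s - x) ^ n) s * greenIntegrand n g t s =
      (t ^ (n + 1) * g t / (Nat.factorial n : ℝ)) * ∫ s in Set.uIoc (max x t) 1,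
        (s - x) ^ n * (s - t) ^ n / s ^ (2 * (n + 1)) := by
    rw [hset, ← setIntegral_indicator (measurableSet_uIoc.inter measurableSet_Ioi),
      ← integral_const_mul]
    refine integral_congr_ae (ae_of_all _ fun s => ?_)
    by_cases h1 : s ∈ Set.uIoc (max x 0) 1 <;> by_cases h2 : t < s
    · have h3 : s ∈ Set.uIoc (max x 0) 1 ∩ Set.Ioi t := ⟨h1, h2⟩
      simp only [Set.indicator_of_mem h1, Set.indicator_of_mem h3, greenIntegrand, if_pos h2]
      ring
    · have h3 : s ∉ Set.uIoc (max x 0) 1 ∩ Set.Ioi t := fun h => h2 h.2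
      simp only [Set.indicator_of_mem h1, Set.indicator_of_notMem h3, greenIntegrand, if_neg h2,
        mul_zero]
    · have h3 : s ∉ Set.uIoc (max x 0) 1 ∩ Set.Ioi t := fun h => h1 h.1
      simp only [Set.indicator_of_notMem h1, Set.indicator_of_notMem h3, zero_mul, mul_zero]
    · have h3 : s ∉ Set.uIoc (max x 0) 1 ∩ Set.Ioi t := fun h => h1 h.1
      simp only [Set.indicator_of_notMem h1, Set.indicator_of_notMem h3, zero_mul, mul_zero]
  rw [hint, smul_eq_mul]
  field_simp

/-- The Green primitive is `x ^ p` times a `p`-fold iterated primitive based at `1`. -/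
lemma jgreen_eq (n : ℕ) {g : ℝ → ℝ} (hg : IntegrableOn g (Set.Ioo 0 1)) :
    Jgreen (n + 1) g = fun x => x ^ (n + 1) * cauchyPrim n (greenDensity n g) 1 x := by
  funext x
  have hsub : Set.uIoc (max x 0) 1 ⊆ Set.Ioi 0 := fun s hs => by
    have := hs.1
    exact lt_of_le_of_lt (le_min (le_max_right _ _) zero_le_one) this
  have hK := integrable_greenIntegrand n hg
  have hbK : Integrable (Function.uncurry fun t s =>
      Set.indicator (Set.uIoc (max x 0) 1) (fun s => (s - x) ^ n) s * greenIntegrand n g t s)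
      ((volume.restrict (Set.Ioo (0 : ℝ) 1)).prod (volume.restrict (Set.Ioi (0 : ℝ)))) := by
    refine Integrable.bdd_mul (c := (|x| + 1) ^ n) hK ?_ (ae_of_all _ fun q => ?_)
    · have : Measurable fun s : ℝ => Set.indicator (Set.uIoc (max x 0) 1) (fun s => (s - x) ^ n) s :=
        Measurable.indicator (by fun_prop) measurableSet_uIoc
      exact (this.comp measurable_snd).aestronglyMeasurable
    · by_cases h : q.2 ∈ Set.uIoc (max x 0) 1
      · rw [Set.indicator_of_mem h, norm_pow]
        refine pow_le_pow_left₀ (norm_nonneg _) ?_ _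
        have h0 : 0 < q.2 := hsub h
        have h1 : q.2 ≤ |x| + 1 := h.2.trans
          (max_le (max_le ((le_abs_self x).trans (by linarith)) (by positivity))
            (by linarith [abs_nonneg x]))
        rw [Real.norm_eq_abs, abs_le]
        by_cases h2 : x ≤ 1
        · rw [Set.uIoc_of_le (max_le h2 zero_le_one)] at h
          have h3 := (max_lt_iff.1 h.1).1
          have h4 := h.2
          exact ⟨by linarith [abs_nonneg x], by linarith [neg_abs_le x]⟩
        · have h3 : |x| = x := abs_of_nonneg (by linarith)
          rw [h3] at h1 ⊢
          constructor <;> linarith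
      · rw [Set.indicator_of_notMem h, norm_zero]; positivity
  rw [Jgreen, intervalIntegral.integral_of_le zero_le_one, integral_Ioc_eq_integral_Ioo,
    setIntegral_congr_fun measurableSet_Ioo fun t ht => greenK_mul_eq n g x ht,
    integral_const_mul, integral_integral_swap hbK]
  have h1 : ∫ s in Set.Ioi (0 : ℝ), ∫ t in Set.Ioo (0 : ℝ) 1,
      Set.indicator (Set.uIoc (max x 0) 1) (fun s => (s - x) ^ n) s * greenIntegrand n g t s =
      ∫ s in Set.uIoc (max x 0) 1, (s - x) ^ n * greenDensity n g s := by
    rw [← Set.inter_eq_right.2 hsub, ← setIntegral_indicator measurableSet_uIoc]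
    refine setIntegral_congr_fun measurableSet_Ioi fun s hs => ?_
    simp only [integral_const_mul, integral_greenIntegrand n g hs]
    by_cases h : s ∈ Set.uIoc (max x 0) 1
    · have h' : s ∈ Set.Ioi 0 ∩ Set.uIoc (max x 0) 1 := ⟨hs, h⟩
      simp [h, hs]
    · simp [h]
  rw [h1]
  have hPi : ∀ a b, IntervalIntegrable (fun s => (s - x) ^ n * greenDensity n g s) volume a b :=
    fun a b => (integrable_greenDensity n hg).intervalIntegrable.continuousOn_mul (by fun_prop)
  have h2 : (if x ≤ 1 then (1 : ℝ) else -1) *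
      ∫ s in Set.uIoc (max x 0) 1, (s - x) ^ n * greenDensity n g s =
      ∫ s in x..1, (s - x) ^ n * greenDensity n g s := by
    have h3 : (if x ≤ 1 then (1 : ℝ) else -1) *
        ∫ s in Set.uIoc (max x 0) 1, (s - x) ^ n * greenDensity n g s =
        ∫ s in (max x 0)..1, (s - x) ^ n * greenDensity n g s := by
      rw [intervalIntegral.intervalIntegral_eq_integral_uIoc]
      simp
    have h4 : ∫ s in x..(max x 0), (s - x) ^ n * greenDensity n g s = 0 := by
      rw [intervalIntegral.integral_of_le (le_max_left _ _)]
      refine setIntegral_eq_zero_of_forall_eq_zero fun s hs => ?_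
      have hs0 : s ≤ 0 := by
        rcases le_total x 0 with h | h
        · simpa [h] using hs.2
        · have := hs.1; have := hs.2; rw [max_eq_left h] at this; linarith
      rw [greenDensity_of_nonpos n g hs0, mul_zero]
    rw [h3, ← intervalIntegral.integral_add_adjacent_intervals (hPi x (max x 0)) (hPi _ _), h4,
      zero_add]
  have h5 : ∫ s in x..1, (s - x) ^ n * greenDensity n g s =
      (-1) ^ (n + 1) * (Nat.factorial n : ℝ) * cauchyPrim n (greenDensity n g) 1 x := by
    rw [intervalIntegral.integral_symm, cauchyPrim, ← intervalIntegral.integral_const_mul,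
      ← intervalIntegral.integral_neg]
    refine intervalIntegral.integral_congr fun s _ => ?_
    have h6 : (s - x) ^ n = (-1) ^ n * (x - s) ^ n := by rw [← mul_pow]; ring
    simp only [h6]
    have : (Nat.factorial n : ℝ) ≠ 0 := by positivity
    field_simp
    ring
  rw [mul_assoc (x ^ (n + 1) / (Nat.factorial n : ℝ)), h2, h5]
  have h7 : ((-1 : ℝ) ^ (n + 1)) * (-1) ^ (n + 1) = 1 := by rw [← mul_pow]; norm_num
  have : (Nat.factorial n : ℝ) ≠ 0 := by positivity
  field_simp
  linear_combination (x ^ (n + 1) * cauchyPrim n (greenDensity n g) 1 x) * h7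

lemma intervalIntegrable_greenWeight (n : ℕ) {g : ℝ → ℝ} (hg : IntegrableOn g (Set.Ioo 0 1))
    (a b : ℝ) : IntervalIntegrable (greenWeight n g) volume a b :=
  (integrable_greenWeight n hg).intervalIntegrable

lemma intervalIntegrable_greenDensity (n : ℕ) {g : ℝ → ℝ} (hg : IntegrableOn g (Set.Ioo 0 1))
    (a b : ℝ) : IntervalIntegrable (greenDensity n g) volume a b :=
  (integrable_greenDensity n hg).intervalIntegrable

lemma continuousOn_greenWeight (n : ℕ) {g : ℝ → ℝ} (hc : ContinuousOn g (Set.Ioo 0 1)) :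
    ContinuousOn (greenWeight n g) (Set.Ioo 0 1) := by
  have h : ContinuousOn (fun t => t ^ (n + 1) * g t) (Set.Ioo 0 1) := by fun_prop
  exact h.congr fun t ht => by rw [greenWeight, Set.indicator_of_mem ht]

lemma contDiffOn_greenDensity (n : ℕ) {g : ℝ → ℝ} (hg : IntegrableOn g (Set.Ioo 0 1))
    (hc : ContinuousOn g (Set.Ioo 0 1)) :
    ContDiffOn ℝ (n + 1 : ℕ) (greenDensity n g) (Set.Ioo 0 1) := by
  have h := contDiffOn_cauchyPrim (intervalIntegrable_greenWeight n hg) isOpen_Ioo (m := 0)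
    (contDiffOn_zero.2 (continuousOn_greenWeight n hc)) n 0
  rw [zero_add] at h
  exact h.div (contDiff_id.pow _).contDiffOn fun x hx => pow_ne_zero _ hx.1.ne'

lemma contDiff_jgreen (n : ℕ) {g : ℝ → ℝ} (hg : IntegrableOn g (Set.Ioo 0 1)) :
    ContDiff ℝ n (Jgreen (n + 1) g) := by
  rw [jgreen_eq n hg]
  exact (contDiff_id.pow _).mul (contDiff_cauchyPrim (intervalIntegrable_greenDensity n hg) n 1)

lemma contDiffAt_cauchyPrim_greenDensity (n : ℕ) {g : ℝ → ℝ} (hg : IntegrableOn g (Set.Ioo 0 1))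
    (hc : ContinuousOn g (Set.Ioo 0 1)) {x : ℝ} (hx : x ∈ Set.Ioo (0 : ℝ) 1) :
    ContDiffAt ℝ (2 * (n + 1) : ℕ) (cauchyPrim n (greenDensity n g) 1) x := by
  have h := (contDiffOn_cauchyPrim (intervalIntegrable_greenDensity n hg) isOpen_Ioo
    (contDiffOn_greenDensity n hg hc) n 1).contDiffAt (isOpen_Ioo.mem_nhds hx)
  rwa [show n + 1 + n + 1 = 2 * (n + 1) by ring] at h

lemma contDiffAt_jgreen (n : ℕ) {g : ℝ → ℝ} (hg : IntegrableOn g (Set.Ioo 0 1))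
    (hc : ContinuousOn g (Set.Ioo 0 1)) {x : ℝ} (hx : x ∈ Set.Ioo (0 : ℝ) 1) :
    ContDiffAt ℝ (2 * (n + 1) : ℕ) (Jgreen (n + 1) g) x := by
  rw [jgreen_eq n hg]
  exact (contDiff_id.pow _).contDiffAt.mul (contDiffAt_cauchyPrim_greenDensity n hg hc hx)

lemma differentiableAt_iteratedDeriv_jgreen (n : ℕ) {g : ℝ → ℝ}
    (hg : IntegrableOn g (Set.Ioo 0 1)) (hc : ContinuousOn g (Set.Ioo 0 1)) {j : ℕ}
    (hj : j < 2 * (n + 1)) {x : ℝ} (hx : x ∈ Set.Ioo (0 : ℝ) 1) :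
    DifferentiableAt ℝ (iteratedDeriv j (Jgreen (n + 1) g)) x := by
  have h : ContDiffAt ℝ (1 + j : ℕ) (Jgreen (n + 1) g) x :=
    (contDiffAt_jgreen n hg hc hx).of_le (by norm_cast; omega)
  exact (contDiffAt_iteratedDeriv h).differentiableAt (by simp)

lemma iteratedDeriv_jgreen_boundary (n : ℕ) {g : ℝ → ℝ} (hg : IntegrableOn g (Set.Ioo 0 1))
    {j : ℕ} (hj : j < n + 1) :
    iteratedDeriv j (Jgreen (n + 1) g) 0 = 0 ∧ iteratedDeriv j (Jgreen (n + 1) g) 1 = 0 := by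
  have hI := intervalIntegrable_greenDensity n hg
  have hP : ContDiff ℝ j (cauchyPrim n (greenDensity n g) 1) :=
    (contDiff_cauchyPrim hI n 1).of_le (by norm_cast; omega)
  have hpow : ∀ x : ℝ, ContDiffAt ℝ j (fun z : ℝ => z ^ (n + 1)) x := fun x =>
    (contDiff_id.pow (n + 1)).contDiffAt
  rw [jgreen_eq n hg, iteratedDeriv_fun_mul (hpow 0) hP.contDiffAt,
    iteratedDeriv_fun_mul (hpow 1) hP.contDiffAt]
  constructor
  · refine Finset.sum_eq_zero fun i hi => ?_
    have hi' : i ≤ j := by simpa [Nat.lt_succ_iff] using hi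
    rw [iteratedDeriv_pow, zero_pow (by omega)]
    simp
  · refine Finset.sum_eq_zero fun i hi => ?_
    have h := iteratedDeriv_cauchyPrim hI (j - i) (n - (j - i)) 1
    rw [show n - (j - i) + (j - i) = n by omega] at h
    rw [h, cauchyPrim_self, mul_zero]

lemma iteratedDeriv_jgreen (n : ℕ) {g : ℝ → ℝ} (hg : IntegrableOn g (Set.Ioo 0 1))
    (hc : ContinuousOn g (Set.Ioo 0 1)) {x : ℝ} (hx : x ∈ Set.Ioo (0 : ℝ) 1) :
    iteratedDeriv (2 * (n + 1)) (Jgreen (n + 1) g) x = g x := by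
  have h1 := iteratedDeriv_pow_mul_eq (n + 1) (contDiffAt_cauchyPrim_greenDensity n hg hc hx)
  have h2 : (fun z => z ^ (2 * (n + 1)) *
      iteratedDeriv (n + 1) (cauchyPrim n (greenDensity n g) 1) z) =ᶠ[nhds x]
      cauchyPrim n (greenWeight n g) 0 := by
    filter_upwards [isOpen_Ioo.mem_nhds hx] with z hz
    rw [iteratedDeriv_succ_cauchyPrim (intervalIntegrable_greenDensity n hg) isOpen_Ioo
      (contDiffOn_greenDensity n hg hc).continuousOn n 1 hz, greenDensity,
      mul_div_cancel₀ _ (pow_ne_zero _ hz.1.ne')]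
  rw [h2.iteratedDeriv_eq, iteratedDeriv_succ_cauchyPrim (intervalIntegrable_greenWeight n hg)
    isOpen_Ioo (continuousOn_greenWeight n hc) n 0 hx, greenWeight, Set.indicator_of_mem hx,
    ← jgreen_eq n hg] at h1
  exact mul_left_cancel₀ (pow_ne_zero _ hx.1.ne') h1

lemma LocLip01.continuousOn {ψ : ℝ → ℝ} (h : LocLip01 ψ) : ContinuousOn ψ (Set.Ioo 0 1) := by
  intro x hx
  have hx0 := hx.1
  have hx1 := hx.2
  obtain ⟨K, hK⟩ := h (x / 2) ((1 + x) / 2) (by linarith) (by linarith) (by linarith)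
  have hL : LipschitzOnWith (Real.toNNReal K) ψ (Set.Icc (x / 2) ((1 + x) / 2)) :=
    LipschitzOnWith.of_dist_le_mul fun z hz z' hz' => by
      rw [Real.dist_eq, Real.dist_eq]
      exact (hK z hz z' hz').trans
        (mul_le_mul_of_nonneg_right (Real.le_coe_toNNReal K) (abs_nonneg _))
  exact (hL.continuousOn.continuousAt
    (Icc_mem_nhds (by linarith) (by linarith))).continuousWithinAt

lemma exists_le_rpow_of_isBigO {h : ℝ → ℝ} {γ : ℝ} (hγ : 0 ≤ γ)
    (hc : ContinuousOn h (Set.Ioo 0 1))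
    (hO : h =O[nhdsWithin 0 (Set.Ioi 0)] fun t : ℝ => t ^ (-γ)) {b : ℝ} (hb : b < 1) :
    ∃ C, 0 ≤ C ∧ ∀ t ∈ Set.Ioc 0 b, ‖h t‖ ≤ C * t ^ (-γ) := by
  obtain ⟨C, hC⟩ := hO.bound
  obtain ⟨δ, hδ, hsub⟩ := mem_nhdsGT_iff_exists_Ioo_subset.1 hC
  have hδ0 : (0 : ℝ) < δ := hδ
  obtain ⟨M, hM⟩ := isCompact_Icc.exists_bound_of_continuousOn
    (hc.mono (show Set.Icc δ b ⊆ Set.Ioo 0 1 from fun t ht => ⟨hδ0.trans_le ht.1, ht.2.trans_lt hb⟩))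
  refine ⟨max (max C M) 0, le_max_right _ _, fun t ht => ?_⟩
  have hpos : 0 < t ^ (-γ) := Real.rpow_pos_of_pos ht.1 _
  rcases lt_or_ge t δ with h1 | h1
  · have h2 : ‖h t‖ ≤ C * ‖t ^ (-γ)‖ := hsub ⟨ht.1, h1⟩
    rw [Real.norm_of_nonneg hpos.le] at h2
    exact h2.trans (mul_le_mul_of_nonneg_right
      ((le_max_left _ _).trans (le_max_left _ _)) hpos.le)
  · have h3 : 1 ≤ t ^ (-γ) :=
      Real.one_le_rpow_of_pos_of_le_one_of_nonpos ht.1 (ht.2.trans hb.le) (by linarith)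
    calc ‖h t‖ ≤ M := hM t ⟨h1, ht.2⟩
      _ ≤ max (max C M) 0 := (le_max_right _ _).trans (le_max_left _ _)
      _ ≤ max (max C M) 0 * t ^ (-γ) := le_mul_of_one_le_right (le_max_right _ _) h3

lemma intervalIntegrable_half_of_isBigO {h : ℝ → ℝ} {γ : ℝ} (hγ : 0 ≤ γ) (hγ1 : γ < 1)
    (hc : ContinuousOn h (Set.Ioo 0 1))
    (hO : h =O[nhdsWithin 0 (Set.Ioi 0)] fun t : ℝ => t ^ (-γ)) :
    IntervalIntegrable h volume 0 (1 / 2) := by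
  obtain ⟨C, -, hC⟩ := exists_le_rpow_of_isBigO hγ hc hO (b := 1 / 2) (by norm_num)
  rw [intervalIntegrable_iff_integrableOn_Ioc_of_le (by norm_num)]
  have h1 : IntegrableOn (fun t : ℝ => C * t ^ (-γ)) (Set.Ioc 0 (1 / 2)) := by
    rw [← intervalIntegrable_iff_integrableOn_Ioc_of_le (by norm_num)]
    exact (intervalIntegral.intervalIntegrable_rpow' (by linarith)).const_mul C
  refine h1.mono' ?_ (ae_restrict_of_forall_mem measurableSet_Ioc hC)
  refine (hc.mono fun t ht => ?_).aestronglyMeasurable measurableSet_Ioc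
  exact ⟨ht.1, ht.2.trans_lt (by norm_num)⟩

lemma integrableOn_Ioo_of_isBigO {h : ℝ → ℝ} {γ : ℝ} (hγ : 0 ≤ γ) (hγ1 : γ < 1)
    (hc : ContinuousOn h (Set.Ioo 0 1))
    (hO : h =O[nhdsWithin 0 (Set.Ioi 0)] fun t : ℝ => t ^ (-γ))
    (hO' : (fun t => h (1 - t)) =O[nhdsWithin 0 (Set.Ioi 0)] fun t : ℝ => t ^ (-γ)) :
    IntegrableOn h (Set.Ioo 0 1) := by
  have h1 := intervalIntegrable_half_of_isBigO hγ hγ1 hc hO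
  have hc' : ContinuousOn (fun t => h (1 - t)) (Set.Ioo 0 1) :=
    hc.comp (by fun_prop) fun t ht => ⟨by linarith [ht.2], by linarith [ht.1]⟩
  have h2 := (intervalIntegrable_half_of_isBigO hγ hγ1 hc' hO').comp_sub_left 1
  simp only [sub_sub_cancel, sub_zero] at h2
  norm_num at h2
  have h3 := h1.trans h2.symm
  exact ((intervalIntegrable_iff_integrableOn_Ioc_of_le zero_le_one).1 h3).mono_set
    Set.Ioo_subset_Ioc_self

lemma intervalIntegrable_rpow_mul_one_sub_rpow {c d : ℝ} (hc : 0 < c) (hd : 0 < d) :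
    IntervalIntegrable (fun u : ℝ => u ^ (c - 1) * (1 - u) ^ (d - 1)) volume 0 1 := by
  have h := (Complex.betaIntegral_convergent (u := c) (v := d) (by simpa) (by simpa)).norm
  refine h.congr fun u hu => ?_
  rw [Set.uIoc_of_le zero_le_one] at hu
  have h0 : (0 : ℝ) ≤ 1 - u := by linarith [hu.2]
  have e : (u : ℂ) ^ ((c : ℂ) - 1) * (1 - (u : ℂ)) ^ ((d : ℂ) - 1) =
      ((u ^ (c - 1) * (1 - u) ^ (d - 1) : ℝ) : ℂ) := by
    rw [Complex.ofReal_mul, Complex.ofReal_cpow hu.1.le, Complex.ofReal_cpow h0]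
    push_cast
    rfl
  simp only [e, Complex.norm_real]
  exact Real.norm_of_nonneg (mul_nonneg (Real.rpow_nonneg hu.1.le _) (Real.rpow_nonneg h0 _))

lemma integral_rpow_mul_one_sub_rpow {c d : ℝ} (hc : 0 < c) (hd : 0 < d) :
    ∫ u in (0 : ℝ)..1, u ^ (c - 1) * (1 - u) ^ (d - 1) =
      Real.Gamma c * Real.Gamma d / Real.Gamma (c + d) := by
  have h := ProbabilityTheory.beta_eq_betaIntegralReal c d hc hd
  rw [ProbabilityTheory.beta] at h
  rw [h, Complex.betaIntegral]
  have e : ∫ u in (0 : ℝ)..1, (u : ℂ) ^ ((c : ℂ) - 1) * (1 - (u : ℂ)) ^ ((d : ℂ) - 1) =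
      ∫ u in (0 : ℝ)..1, ((u ^ (c - 1) * (1 - u) ^ (d - 1) : ℝ) : ℂ) := by
    refine intervalIntegral.integral_congr fun u hu => ?_
    rw [Set.uIcc_of_le zero_le_one] at hu
    have h0 : (0 : ℝ) ≤ 1 - u := by linarith [hu.2]
    rw [Complex.ofReal_mul, Complex.ofReal_cpow hu.1, Complex.ofReal_cpow h0]
    push_cast
    rfl
  rw [e, intervalIntegral.integral_ofReal, Complex.ofReal_re]

lemma norm_one_sub_rpow_mul_le {ψ : ℝ → ℝ} {γ C r b a' x u : ℝ}
    (hγ : 0 ≤ γ) (hC0 : 0 ≤ C) (hC : ∀ t ∈ Set.Ioc 0 b, ‖ψ t‖ ≤ C * t ^ (-γ))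
    (ha' : 0 < a') (hx : x ∈ Set.Icc a' b) (hu : u ∈ Set.Ioc (0 : ℝ) 1) :
    ‖(1 - u) ^ r * ψ (x * u)‖ ≤ C * a' ^ (-γ) * (u ^ (-γ) * (1 - u) ^ r) := by
  have hx0 : 0 < x := ha'.trans_le hx.1
  have h1 : ‖ψ (x * u)‖ ≤ C * (x * u) ^ (-γ) :=
    hC _ ⟨mul_pos hx0 hu.1, (mul_le_of_le_one_right hx0.le hu.2).trans hx.2⟩
  have h2 : (x * u) ^ (-γ) ≤ a' ^ (-γ) * u ^ (-γ) := by
    rw [Real.mul_rpow hx0.le hu.1.le]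
    exact mul_le_mul_of_nonneg_right (Real.rpow_le_rpow_of_nonpos ha' hx.1 (by linarith))
      (Real.rpow_nonneg hu.1.le _)
  have h3 : 0 ≤ (1 - u) ^ r := Real.rpow_nonneg (by linarith [hu.2]) _
  rw [norm_mul, Real.norm_of_nonneg h3]
  calc (1 - u) ^ r * ‖ψ (x * u)‖ ≤ (1 - u) ^ r * (C * (a' ^ (-γ) * u ^ (-γ))) :=
        mul_le_mul_of_nonneg_left (h1.trans (mul_le_mul_of_nonneg_left h2 hC0)) h3
    _ = _ := by ring

lemma aestronglyMeasurable_one_sub_rpow_mul {ψ : ℝ → ℝ} (hc : ContinuousOn ψ (Set.Ioo 0 1))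
    {x : ℝ} (hx : x ∈ Set.Ioo (0 : ℝ) 1) (r : ℝ) :
    AEStronglyMeasurable (fun u => (1 - u) ^ r * ψ (x * u))
      (volume.restrict (Set.uIoc (0 : ℝ) 1)) := by
  rw [Set.uIoc_of_le zero_le_one]
  have h1 : Measurable fun u : ℝ => (1 - u) ^ r := by fun_prop
  refine h1.aestronglyMeasurable.mul (ContinuousOn.aestronglyMeasurable ?_ measurableSet_Ioc)
  exact hc.comp (by fun_prop) fun u hu => ⟨mul_pos hx.1 hu.1,
    (mul_le_of_le_one_right hx.1.le hu.2).trans_lt hx.2⟩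

lemma intervalIntegrable_sub_rpow_mul {ψ : ℝ → ℝ} {a γ x : ℝ} (ha : 0 < a) (hγ : 0 ≤ γ)
    (hγ1 : γ < 1) (hc : ContinuousOn ψ (Set.Ioo 0 1))
    (hO : ψ =O[nhdsWithin 0 (Set.Ioi 0)] fun t : ℝ => t ^ (-γ)) (hx : x ∈ Set.Ioo (0 : ℝ) 1) :
    IntervalIntegrable (fun s => (x - s) ^ (a - 1) * ψ s) volume 0 x := by
  obtain ⟨C, hC0, hC⟩ := exists_le_rpow_of_isBigO hγ hc hO hx.2
  have hb := intervalIntegrable_rpow_mul_one_sub_rpow (c := 1 - γ) (d := a) (by linarith) ha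
  have h1 : IntervalIntegrable (fun u => (1 - u) ^ (a - 1) * ψ (x * u)) volume 0 1 := by
    refine (hb.const_mul (C * x ^ (-γ))).mono_fun'
      (aestronglyMeasurable_one_sub_rpow_mul hc hx _) ?_
    refine ae_restrict_of_forall_mem measurableSet_uIoc fun u hu => ?_
    rw [Set.uIoc_of_le zero_le_one] at hu
    have := norm_one_sub_rpow_mul_le (r := a - 1) hγ hC0 hC hx.1 ⟨le_rfl, le_rfl⟩ hu
    simpa [show 1 - γ - 1 = -γ by ring] using this
  have h2 := (h1.comp_mul_left (c := x⁻¹)).const_mul (x ^ (a - 1))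
  have hx0 := hx.1.ne'
  simp only [zero_mul, div_inv_eq_mul, one_mul] at h2
  refine h2.congr fun s hs => ?_
  rw [Set.uIoc_of_le hx.1.le] at hs
  rw [mul_inv_cancel_left₀ hx0, ← mul_assoc, ← Real.mul_rpow hx.1.le]
  · congr 2; field_simp
  · rw [sub_nonneg, inv_mul_le_one₀ hx.1]; exact hs.2

lemma continuousOn_integral_sub_rpow_mul {ψ : ℝ → ℝ} {a γ : ℝ} (ha : 0 < a) (hγ : 0 ≤ γ)
    (hγ1 : γ < 1) (hc : ContinuousOn ψ (Set.Ioo 0 1))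
    (hO : ψ =O[nhdsWithin 0 (Set.Ioi 0)] fun t : ℝ => t ^ (-γ)) :
    ContinuousOn (fun x => ∫ s in (0 : ℝ)..x, (x - s) ^ (a - 1) * ψ s) (Set.Ioo 0 1) := by
  have hF : ∀ x ∈ Set.Ioo (0 : ℝ) 1, ∫ s in (0 : ℝ)..x, (x - s) ^ (a - 1) * ψ s =
      x ^ a * ∫ u in (0 : ℝ)..1, (1 - u) ^ (a - 1) * ψ (x * u) := fun x hx => by
    have h := intervalIntegral.smul_integral_comp_mul_left (a := 0) (b := 1)
      (fun s => (x - s) ^ (a - 1) * ψ s) x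
    rw [mul_zero, mul_one, smul_eq_mul] at h
    rw [← h, ← intervalIntegral.integral_const_mul, ← intervalIntegral.integral_const_mul]
    refine intervalIntegral.integral_congr fun u hu => ?_
    rw [Set.uIcc_of_le zero_le_one] at hu
    rw [show x - x * u = x * (1 - u) by ring, Real.mul_rpow hx.1.le (by linarith [hu.2]),
      Real.rpow_sub_one hx.1.ne']
    have := hx.1.ne'
    field_simp
  intro x₀ hx₀
  have hx0 := hx₀.1
  have hx1 := hx₀.2
  refine ContinuousWithinAt.congr (ContinuousAt.continuousWithinAt ?_) hF (hF x₀ hx₀)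
  refine (Real.continuousAt_rpow_const _ _ (Or.inl hx0.ne')).mul ?_
  obtain ⟨C, hC0, hC⟩ := exists_le_rpow_of_isBigO hγ hc hO (b := (1 + x₀) / 2) (by linarith)
  have hb := intervalIntegrable_rpow_mul_one_sub_rpow (c := 1 - γ) (d := a) (by linarith) ha
  have hnhds : Set.Icc (x₀ / 2) ((1 + x₀) / 2) ∈ nhds x₀ :=
    Icc_mem_nhds (by linarith) (by linarith)
  refine intervalIntegral.continuousAt_of_dominated_interval ?_ ?_
    (hb.const_mul (C * (x₀ / 2) ^ (-γ))) ?_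
  · filter_upwards [isOpen_Ioo.mem_nhds hx₀] with x hx
    exact aestronglyMeasurable_one_sub_rpow_mul hc hx _
  · filter_upwards [hnhds] with x hx
    refine ae_of_all _ fun u hu => ?_
    rw [Set.uIoc_of_le zero_le_one] at hu
    have := norm_one_sub_rpow_mul_le (r := a - 1) hγ hC0 hC (by linarith) hx hu
    simpa [show 1 - γ - 1 = -γ by ring] using this
  · refine ae_of_all _ fun u hu => ?_
    rw [Set.uIoc_of_le zero_le_one] at hu
    have hmem : x₀ * u ∈ Set.Ioo (0 : ℝ) 1 :=
      ⟨mul_pos hx0 hu.1, (mul_le_of_le_one_right hx0.le hu.2).trans_lt hx1⟩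
    have h1 : ContinuousAt ψ (x₀ * u) := hc.continuousAt (isOpen_Ioo.mem_nhds hmem)
    exact continuousAt_const.mul
      (ContinuousAt.comp (f := fun x => x * u) h1 (by fun_prop))

lemma integrableOn_integral_sub_rpow_mul {ψ : ℝ → ℝ} {a : ℝ} (ha : 0 < a)
    (hψ : IntegrableOn ψ (Set.Ioo 0 1)) :
    IntegrableOn (fun x => ∫ s in (0 : ℝ)..x, (x - s) ^ (a - 1) * ψ s) (Set.Ioo 0 1) := by
  have h1 : Integrable (Set.indicator (Set.Ioo (0 : ℝ) 1) ψ) :=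
    (integrable_indicator_iff measurableSet_Ioo).2 hψ
  have h2 : Integrable (Set.indicator (Set.Ioo (0 : ℝ) 1) fun u => u ^ (a - 1)) := by
    refine (integrable_indicator_iff measurableSet_Ioo).2 ?_
    have h : IntervalIntegrable (fun u : ℝ => u ^ (a - 1)) volume 0 1 :=
      intervalIntegral.intervalIntegrable_rpow' (by linarith)
    exact ((intervalIntegrable_iff_integrableOn_Ioc_of_le zero_le_one).1 h).mono_set
      Set.Ioo_subset_Ioc_self
  have h3 := (h1.integrable_convolution (ContinuousLinearMap.mul ℝ ℝ) h2).integrableOn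
    (s := Set.Ioo 0 1)
  refine h3.congr_fun (fun x hx => ?_) measurableSet_Ioo
  simp only [convolution, ContinuousLinearMap.mul_apply']
  rw [intervalIntegral.integral_of_le hx.1.le, integral_Ioc_eq_integral_Ioo,
    ← integral_indicator measurableSet_Ioo]
  refine integral_congr_ae (ae_of_all _ fun s => ?_)
  by_cases h : s ∈ Set.Ioo 0 x
  · have e1 : s ∈ Set.Ioo (0 : ℝ) 1 := ⟨h.1, h.2.trans hx.2⟩
    have e2 : x - s ∈ Set.Ioo (0 : ℝ) 1 := ⟨by linarith [h.2], by linarith [h.1, hx.2]⟩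
    simp only [Set.indicator_of_mem h, Set.indicator_of_mem e1, Set.indicator_of_mem e2]
    ring
  · simp only [Set.indicator_of_notMem h]
    by_cases e1 : s ∈ Set.Ioo (0 : ℝ) 1
    · have e2 : x - s ∉ Set.Ioo (0 : ℝ) 1 := fun e => h ⟨e1.1, by linarith [e.1]⟩
      rw [Set.indicator_of_notMem e2, mul_zero]
    · rw [Set.indicator_of_notMem e1, zero_mul]

lemma hasDerivAt_sub_rpow_mul_rpow_sub {a L τ : ℝ} (h0 : 0 < τ) (h1 : τ < L) :
    HasDerivAt (fun τ : ℝ => (L - τ) ^ (-a) * (τ ^ a - L ^ a))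
      (a * L * ((L - τ) ^ (-a - 1) * (τ ^ (a - 1) - L ^ (a - 1)))) τ := by
  have hL : 0 < L := h0.trans h1
  have hs : 0 < L - τ := sub_pos.2 h1
  have d1 : HasDerivAt (fun τ : ℝ => (L - τ) ^ (-a)) (-1 * (-a) * (L - τ) ^ (-a - 1)) τ :=
    ((hasDerivAt_id τ).const_sub L).rpow_const (Or.inl hs.ne')
  have d2 : HasDerivAt (fun τ : ℝ => τ ^ a - L ^ a) (a * τ ^ (a - 1)) τ :=
    (Real.hasDerivAt_rpow_const (Or.inl h0.ne')).sub_const _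
  refine (d1.mul d2).congr_deriv ?_
  rw [Real.rpow_sub_one hs.ne', Real.rpow_sub_one h0.ne', Real.rpow_sub_one hL.ne']
  field_simp
  ring

lemma continuousOn_sub_rpow_mul_rpow_sub {a L : ℝ} (ha : 0 < a) (ha1 : a < 1) (hL : 0 < L) :
    ContinuousOn (fun τ : ℝ => (L - τ) ^ (-a) * (τ ^ a - L ^ a)) (Set.Icc 0 L) := by
  intro τ hτ
  rcases hτ.2.lt_or_eq with h | rfl
  · have hs : L - τ ≠ 0 := (sub_pos.2 h).ne'
    refine ContinuousAt.continuousWithinAt (ContinuousAt.mul ?_ ?_)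
    · exact ContinuousAt.rpow_const (by fun_prop) (Or.inl hs)
    · exact (Real.continuousAt_rpow_const _ _ (Or.inr ha.le)).sub continuousAt_const
  · have hb : Tendsto (fun t : ℝ => τ ^ (a - 1) * (τ - t) ^ (1 - a))
        (nhdsWithin τ (Set.Icc 0 τ)) (nhds 0) := by
      have hc : Continuous fun t : ℝ => τ ^ (a - 1) * (τ - t) ^ (1 - a) :=
        continuous_const.mul ((continuous_const.sub continuous_id).rpow_const
          fun _ => Or.inr (by linarith))
      have := (hc.tendsto τ).mono_left (nhdsWithin_le_nhds (s := Set.Icc 0 τ))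
      simpa [Real.zero_rpow (show 1 - a ≠ 0 by linarith)] using this
    rw [ContinuousWithinAt, sub_self, sub_self, mul_zero]
    refine squeeze_zero_norm' ?_ hb
    filter_upwards [self_mem_nhdsWithin] with t ht
    have hs : 0 ≤ τ - t := sub_nonneg.2 ht.2
    rcases hs.eq_or_lt with h | h
    · have e : t = τ := by linarith
      subst e
      simp [Real.zero_rpow (show 1 - a ≠ 0 by linarith)]
    · have h1 : t ^ a ≤ τ ^ a := Real.rpow_le_rpow ht.1 ht.2 ha.le
      have h2 : τ ^ (a - 1) * t ≤ t ^ a := by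
        rcases ht.1.eq_or_lt with h0 | h0
        · rw [← h0, Real.zero_rpow ha.ne', mul_zero]
        · calc τ ^ (a - 1) * t ≤ t ^ (a - 1) * t := mul_le_mul_of_nonneg_right
                (Real.rpow_le_rpow_of_nonpos h0 ht.2 (by linarith)) h0.le
            _ = t ^ a := by rw [Real.rpow_sub_one h0.ne']; field_simp
      have h3 : τ ^ a = τ ^ (a - 1) * τ := by rw [Real.rpow_sub_one hL.ne']; field_simp
      rw [norm_mul, Real.norm_of_nonneg (Real.rpow_nonneg hs _), Real.norm_eq_abs,
        abs_sub_comm, abs_of_nonneg (sub_nonneg.2 h1)]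
      calc (τ - t) ^ (-a) * (τ ^ a - t ^ a) ≤ (τ - t) ^ (-a) * (τ ^ (a - 1) * (τ - t)) :=
            mul_le_mul_of_nonneg_left (by linarith) (Real.rpow_nonneg hs _)
        _ = τ ^ (a - 1) * (τ - t) ^ (1 - a) := by
          rw [show 1 - a = -a + 1 by ring, Real.rpow_add_one h.ne']; ring

lemma sub_rpow_mul_rpow_sub_nonneg {a s t x : ℝ} (ha1 : a < 1) (h0 : s < t) (h1 : t < x) :
    0 ≤ (x - t) ^ (-a - 1) * ((t - s) ^ (a - 1) - (x - s) ^ (a - 1)) :=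
  mul_nonneg (Real.rpow_nonneg (sub_pos.2 h1).le _) (sub_nonneg.2
    (Real.rpow_le_rpow_of_nonpos (sub_pos.2 h0) (by linarith) (by linarith)))

lemma intervalIntegrable_sub_rpow_mul_rpow_sub {a L : ℝ} (ha : 0 < a) (ha1 : a < 1)
    (hL : 0 < L) :
    IntervalIntegrable (fun τ => (L - τ) ^ (-a - 1) * (τ ^ (a - 1) - L ^ (a - 1)))
      volume 0 L := by
  have h : IntegrableOn (fun τ => a * L * ((L - τ) ^ (-a - 1) * (τ ^ (a - 1) - L ^ (a - 1))))
      (Set.Ioc 0 L) := by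
    refine intervalIntegral.integrableOn_deriv_of_nonneg
      (continuousOn_sub_rpow_mul_rpow_sub ha ha1 hL)
      (fun τ hτ => hasDerivAt_sub_rpow_mul_rpow_sub hτ.1 hτ.2) fun τ hτ => ?_
    have := sub_rpow_mul_rpow_sub_nonneg ha1 hτ.1 hτ.2
    rw [sub_zero, sub_zero] at this
    positivity
  rw [← intervalIntegrable_iff_integrableOn_Ioc_of_le hL.le] at h
  refine (h.const_mul (a * L)⁻¹).congr fun τ _ => ?_
  field_simp

lemma integral_sub_rpow_mul_rpow_sub {a L : ℝ} (ha : 0 < a) (ha1 : a < 1) (hL : 0 < L) :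
    ∫ τ in (0 : ℝ)..L, (L - τ) ^ (-a - 1) * (τ ^ (a - 1) - L ^ (a - 1)) = 1 / (a * L) := by
  have h := intervalIntegral.integral_eq_sub_of_hasDerivAt_of_le hL.le
    (continuousOn_sub_rpow_mul_rpow_sub ha ha1 hL)
    (fun τ hτ => hasDerivAt_sub_rpow_mul_rpow_sub hτ.1 hτ.2)
    ((intervalIntegrable_sub_rpow_mul_rpow_sub ha ha1 hL).const_mul (a * L))
  rw [intervalIntegral.integral_const_mul] at h
  rw [eq_div_iff (by positivity), mul_comm, h]
  have h2 : L ^ (-a) * L ^ a = 1 := by rw [← Real.rpow_add hL]; simp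
  simp [Real.zero_rpow ha.ne', h2]

lemma intervalIntegrable_translate_sub_rpow_mul {a s x : ℝ} (ha : 0 < a) (ha1 : a < 1)
    (hs : s < x) :
    IntervalIntegrable (fun t => (x - t) ^ (-a - 1) * ((t - s) ^ (a - 1) - (x - s) ^ (a - 1)))
      volume s x := by
  have h := (intervalIntegrable_sub_rpow_mul_rpow_sub ha ha1 (sub_pos.2 hs)).comp_sub_right s
  simpa using h

lemma integral_translate_sub_rpow_mul {a s x : ℝ} (ha : 0 < a) (ha1 : a < 1) (hs : s < x) :
    ∫ t in s..x, (x - t) ^ (-a - 1) * ((t - s) ^ (a - 1) - (x - s) ^ (a - 1)) =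
      1 / (a * (x - s)) := by
  rw [← integral_sub_rpow_mul_rpow_sub ha ha1 (sub_pos.2 hs)]
  have h := intervalIntegral.integral_comp_sub_right (a := s) (b := x)
    (fun τ => (x - s - τ) ^ (-a - 1) * (τ ^ (a - 1) - (x - s) ^ (a - 1))) s
  rw [sub_self] at h
  rw [← h]
  simp

lemma intervalIntegrable_sub_rpow_neg {a s x : ℝ} (h0 : 0 ≤ s) (hs : s < x) :
    IntervalIntegrable (fun t => (x - t) ^ (-a - 1)) volume 0 s := by
  refine ContinuousOn.intervalIntegrable ?_
  rw [Set.uIcc_of_le h0]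
  exact ContinuousOn.rpow_const (by fun_prop) fun t ht => Or.inl (by linarith [ht.2])

lemma integral_sub_rpow_neg {a s x : ℝ} (ha : 0 < a) (h0 : 0 ≤ s) (hs : s < x) :
    ∫ t in (0 : ℝ)..s, (x - t) ^ (-a - 1) = ((x - s) ^ (-a) - x ^ (-a)) / a := by
  have hmem : (0 : ℝ) ∉ Set.uIcc (x - s) x := by
    rw [Set.uIcc_of_le (by linarith)]
    exact fun h => by linarith [h.1]
  rw [intervalIntegral.integral_comp_sub_left (fun u : ℝ => u ^ (-a - 1)), sub_zero,
    integral_rpow (Or.inr ⟨by linarith, hmem⟩), sub_add_cancel]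
  field_simp
  ring

lemma integrable_prod_mul_of_nonneg {μ ν : Measure ℝ} [SFinite μ] [SFinite ν]
    {κ : ℝ × ℝ → ℝ} {φ : ℝ → ℝ} (hκ : AEStronglyMeasurable κ (μ.prod ν))
    (hφ : AEStronglyMeasurable φ ν) (h0 : ∀ᵐ s ∂ν, ∀ᵐ t ∂μ, 0 ≤ κ (t, s))
    (h1 : ∀ᵐ s ∂ν, Integrable (fun t => κ (t, s)) μ)
    (h2 : Integrable (fun s => (∫ t, κ (t, s) ∂μ) * φ s) ν) :
    Integrable (fun z => κ z * φ z.2) (μ.prod ν) := by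
  have hm : AEStronglyMeasurable (fun z => κ z * φ z.2) (μ.prod ν) := hκ.mul hφ.comp_snd
  rw [integrable_prod_iff' hm]
  refine ⟨h1.mono fun s hs => hs.mul_const (φ s), h2.norm.congr ?_⟩
  filter_upwards [h0] with s hs
  simp only [norm_mul]
  rw [integral_mul_const, Real.norm_of_nonneg (integral_nonneg_of_ae hs)]
  congr 1
  exact integral_congr_ae (hs.mono fun t ht => (Real.norm_of_nonneg ht).symm)

lemma integral_marchaud_of_integrable {φ : ℝ → ℝ} {a x : ℝ} (ha : 0 < a) (ha1 : a < 1)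
    (hx : 0 < x) (hφ : AEStronglyMeasurable φ (volume.restrict (Set.Ioo 0 x)))
    (h1 : IntegrableOn (fun s => φ s / (x - s)) (Set.Ioo 0 x))
    (h2 : ∀ t ∈ Set.Ioc 0 x, IntegrableOn (fun s => (t - s) ^ (a - 1) * φ s) (Set.Ioo 0 t)) :
    IntegrableOn (fun t => (x - t) ^ (-a - 1) * ((∫ s in Set.Ioo 0 t, (t - s) ^ (a - 1) * φ s) -
        ∫ s in Set.Ioo 0 x, (x - s) ^ (a - 1) * φ s)) (Set.Ioo 0 x) ∧
      ∫ t in Set.Ioo 0 x, (x - t) ^ (-a - 1) * ((∫ s in Set.Ioo 0 t, (t - s) ^ (a - 1) * φ s) -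
        ∫ s in Set.Ioo 0 x, (x - s) ^ (a - 1) * φ s) =
      (∫ s in Set.Ioo 0 x, (x - s) ^ (a - 1) * φ s) * x ^ (-a) / a := by
  set μ : Measure ℝ := volume.restrict (Set.Ioo 0 x) with hμ
  have hx2 := h2 x ⟨hx, le_rfl⟩
  set κR : ℝ × ℝ → ℝ := Set.indicator {z | z.2 < z.1}
    (fun z => (x - z.1) ^ (-a - 1) * ((z.1 - z.2) ^ (a - 1) - (x - z.2) ^ (a - 1))) with hR
  set κL : ℝ × ℝ → ℝ := Set.indicator {z | z.1 ≤ z.2}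
    (fun z => (x - z.1) ^ (-a - 1) * (x - z.2) ^ (a - 1)) with hL
  have mR : Measurable κR := by
    refine Measurable.indicator ?_ (measurableSet_lt measurable_snd measurable_fst)
    fun_prop
  have mL : Measurable κL := by
    refine Measurable.indicator ?_ (measurableSet_le measurable_fst measurable_snd)
    fun_prop
  have sR : ∀ s, (fun t => κR (t, s)) = Set.indicator (Set.Ioi s)
      (fun t => (x - t) ^ (-a - 1) * ((t - s) ^ (a - 1) - (x - s) ^ (a - 1))) := fun s => rfl
  have sL : ∀ s, (fun t => κL (t, s)) = Set.indicator (Set.Iic s)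
      (fun t => (x - t) ^ (-a - 1) * (x - s) ^ (a - 1)) := fun s => rfl
  have intR : ∀ s ∈ Set.Ioo 0 x, Set.Ioi s ∩ Set.Ioo 0 x = Set.Ioo s x := fun s hs => by
    ext t; simp only [Set.mem_inter_iff, Set.mem_Ioi, Set.mem_Ioo]
    exact ⟨fun h => ⟨h.1, h.2.2⟩, fun h => ⟨h.1, hs.1.trans h.1, h.2⟩⟩
  have intL : ∀ s ∈ Set.Ioo 0 x, Set.Iic s ∩ Set.Ioo 0 x = Set.Ioc 0 s := fun s hs => by
    ext t; simp only [Set.mem_inter_iff, Set.mem_Iic, Set.mem_Ioo, Set.mem_Ioc]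
    exact ⟨fun h => ⟨h.2.1, h.1⟩, fun h => ⟨h.2, h.1, h.2.trans_lt hs.2⟩⟩
  have iR : ∀ s ∈ Set.Ioo 0 x, Integrable (fun t => κR (t, s)) μ ∧
      ∫ t, κR (t, s) ∂μ = 1 / (a * (x - s)) := fun s hs => by
    rw [sR s, integrable_indicator_iff measurableSet_Ioi, integral_indicator measurableSet_Ioi,
      IntegrableOn, hμ, Measure.restrict_restrict measurableSet_Ioi, intR s hs,
      ← integral_Ioc_eq_integral_Ioo, ← intervalIntegral.integral_of_le hs.2.le]
    exact ⟨((intervalIntegrable_iff_integrableOn_Ioo_of_le hs.2.le).1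
      (intervalIntegrable_translate_sub_rpow_mul ha ha1 hs.2)),
      integral_translate_sub_rpow_mul ha ha1 hs.2⟩
  have iL : ∀ s ∈ Set.Ioo 0 x, Integrable (fun t => κL (t, s)) μ ∧
      ∫ t, κL (t, s) ∂μ = (1 / (x - s) - x ^ (-a) * (x - s) ^ (a - 1)) / a := fun s hs => by
    rw [sL s, integrable_indicator_iff measurableSet_Iic, integral_indicator measurableSet_Iic,
      IntegrableOn, hμ, Measure.restrict_restrict measurableSet_Iic, intL s hs,
      ← intervalIntegral.integral_of_le hs.1.le, intervalIntegral.integral_mul_const,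
      integral_sub_rpow_neg ha hs.1.le hs.2]
    refine ⟨((intervalIntegrable_iff_integrableOn_Ioc_of_le hs.1.le).1
      ((intervalIntegrable_sub_rpow_neg hs.1.le hs.2).mul_const _)), ?_⟩
    have hpos : 0 < x - s := sub_pos.2 hs.2
    have e : (x - s) ^ (-a) * (x - s) ^ (a - 1) = 1 / (x - s) := by
      rw [← Real.rpow_add hpos, show -a + (a - 1) = -1 by ring, Real.rpow_neg_one, one_div]
    rw [div_mul_eq_mul_div, sub_mul, e]
  have aeμ : ∀ {P : ℝ → Prop}, (∀ s ∈ Set.Ioo 0 x, P s) → ∀ᵐ s ∂μ, P s := fun h =>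
    ae_restrict_of_forall_mem measurableSet_Ioo h
  have wR : Integrable (fun s => (∫ t, κR (t, s) ∂μ) * φ s) μ := by
    refine (h1.const_mul a⁻¹).congr (aeμ fun s hs => ?_)
    simp only [(iR s hs).2]
    field_simp
  have wL : Integrable (fun s => (∫ t, κL (t, s) ∂μ) * φ s) μ := by
    refine ((h1.const_mul a⁻¹).sub (hx2.const_mul (a⁻¹ * x ^ (-a)))).congr (aeμ fun s hs => ?_)
    simp only [(iL s hs).2, Pi.sub_apply]
    ring
  have jR : Integrable (fun z : ℝ × ℝ => κR z * φ z.2) (μ.prod μ) := by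
    refine integrable_prod_mul_of_nonneg mR.aestronglyMeasurable hφ ?_
      (aeμ fun s hs => (iR s hs).1) wR
    refine aeμ fun s hs => aeμ fun t ht => Set.indicator_apply_nonneg ?_
    exact fun h => sub_rpow_mul_rpow_sub_nonneg ha1 h ht.2
  have jL : Integrable (fun z : ℝ × ℝ => κL z * φ z.2) (μ.prod μ) := by
    refine integrable_prod_mul_of_nonneg mL.aestronglyMeasurable hφ ?_
      (aeμ fun s hs => (iL s hs).1) wL
    refine aeμ fun s hs => aeμ fun t ht => Set.indicator_apply_nonneg ?_
    exact fun _ => mul_nonneg (Real.rpow_nonneg (sub_pos.2 ht.2).le _)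
      (Real.rpow_nonneg (sub_pos.2 hs.2).le _)
  have key : ∀ t ∈ Set.Ioo 0 x, ∫ s, (κR (t, s) * φ s - κL (t, s) * φ s) ∂μ =
      (x - t) ^ (-a - 1) * ((∫ s in Set.Ioo 0 t, (t - s) ^ (a - 1) * φ s) -
        ∫ s in Set.Ioo 0 x, (x - s) ^ (a - 1) * φ s) := fun t ht => by
    have hsub : Set.Ioo 0 t ∩ Set.Ioo 0 x = Set.Ioo 0 t :=
      Set.inter_eq_left.2 (Set.Ioo_subset_Ioo_right ht.2.le)
    have hi : Integrable (Set.indicator (Set.Ioo 0 t) fun s => (t - s) ^ (a - 1) * φ s) μ := by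
      rw [integrable_indicator_iff measurableSet_Ioo, IntegrableOn, hμ,
        Measure.restrict_restrict measurableSet_Ioo, hsub]
      exact h2 t ⟨ht.1, ht.2.le⟩
    have he : ∫ s, Set.indicator (Set.Ioo 0 t) (fun s => (t - s) ^ (a - 1) * φ s) s ∂μ =
        ∫ s in Set.Ioo 0 t, (t - s) ^ (a - 1) * φ s := by
      rw [integral_indicator measurableSet_Ioo, hμ, Measure.restrict_restrict measurableSet_Ioo,
        hsub]
    rw [← he, ← integral_sub hi hx2, ← integral_const_mul]
    refine integral_congr_ae (aeμ fun s hs => ?_)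
    by_cases h : s < t
    · have e1 : κR (t, s) = (x - t) ^ (-a - 1) * ((t - s) ^ (a - 1) - (x - s) ^ (a - 1)) :=
        Set.indicator_of_mem (show (t, s) ∈ {z : ℝ × ℝ | z.2 < z.1} from h) _
      have e2 : κL (t, s) = 0 :=
        Set.indicator_of_notMem (show (t, s) ∉ {z : ℝ × ℝ | z.1 ≤ z.2} from not_le.2 h) _
      have e3 : s ∈ Set.Ioo 0 t := ⟨hs.1, h⟩
      simp only [e1, e2, Set.indicator_of_mem e3]
      ring
    · have e1 : κR (t, s) = 0 :=
        Set.indicator_of_notMem (show (t, s) ∉ {z : ℝ × ℝ | z.2 < z.1} from h) _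
      have e2 : κL (t, s) = (x - t) ^ (-a - 1) * (x - s) ^ (a - 1) :=
        Set.indicator_of_mem (show (t, s) ∈ {z : ℝ × ℝ | z.1 ≤ z.2} from not_lt.1 h) _
      have e3 : s ∉ Set.Ioo 0 t := fun h' => h h'.2
      simp only [e1, e2, Set.indicator_of_notMem e3]
      ring
  have jj : Integrable (fun z : ℝ × ℝ => κR z * φ z.2 - κL z * φ z.2) (μ.prod μ) := jR.sub jL
  refine ⟨jj.integral_prod_left.congr (aeμ key), ?_⟩
  rw [← integral_congr_ae (aeμ key), integral_integral_swap jj]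
  have hin : ∀ s ∈ Set.Ioo 0 x, ∫ t, (κR (t, s) * φ s - κL (t, s) * φ s) ∂μ =
      x ^ (-a) / a * ((x - s) ^ (a - 1) * φ s) := fun s hs => by
    rw [integral_sub ((iR s hs).1.mul_const _) ((iL s hs).1.mul_const _), integral_mul_const,
      integral_mul_const, (iR s hs).2, (iL s hs).2]
    have hpos : x - s ≠ 0 := (sub_pos.2 hs.2).ne'
    field_simp
    ring
  rw [integral_congr_ae (aeμ hin), integral_const_mul]
  ring

lemma integral_marchaud_rpow {a x : ℝ} (ha : 0 < a) (ha1 : a < 1) (hx : 0 < x) :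
    IntervalIntegrable (fun t => (x - t) ^ (-a - 1) * (t ^ a - x ^ a)) volume 0 x ∧
      ∫ t in (0 : ℝ)..x, (x - t) ^ (-a - 1) * (t ^ a - x ^ a) =
        1 / a - Real.Gamma a * Real.Gamma (1 - a) := by
  have hb : IntervalIntegrable (fun u : ℝ => u ^ (a - 1) * (1 - u) ^ (1 - a - 1)) volume 0 1 :=
    intervalIntegrable_rpow_mul_one_sub_rpow ha (by linarith)
  have hscale : ∀ t ∈ Set.Ioc 0 x, (x⁻¹ * t) ^ (a - 1) * (1 - x⁻¹ * t) ^ (1 - a - 1) =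
      x * ((x - t) ^ (-a) * t ^ (a - 1)) := fun t ht => by
    have e : 1 - x⁻¹ * t = x⁻¹ * (x - t) := by field_simp
    have hxi : 0 < x⁻¹ := inv_pos.2 hx
    rw [e, Real.mul_rpow hxi.le ht.1.le, Real.mul_rpow hxi.le (sub_nonneg.2 ht.2),
      show 1 - a - 1 = -a by ring]
    have e2 : x⁻¹ ^ (a - 1) * x⁻¹ ^ (-a) = x := by
      rw [← Real.rpow_add hxi, show a - 1 + -a = -1 by ring, Real.rpow_neg_one, inv_inv]
    linear_combination (t ^ (a - 1) * (x - t) ^ (-a)) * e2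
  have hbi : IntervalIntegrable (fun t => (x - t) ^ (-a) * t ^ (a - 1)) volume 0 x := by
    have h := (hb.comp_mul_left (c := x⁻¹)).const_mul x⁻¹
    simp only [zero_mul, div_inv_eq_mul, one_mul] at h
    refine h.congr fun t ht => ?_
    rw [Set.uIoc_of_le hx.le] at ht
    simp only [hscale t ht]
    field_simp
  have hbv : ∫ t in (0 : ℝ)..x, (x - t) ^ (-a) * t ^ (a - 1) =
      Real.Gamma a * Real.Gamma (1 - a) := by
    have h := intervalIntegral.inv_smul_integral_comp_div (a := 0) (b := x)
      (fun u : ℝ => u ^ (a - 1) * (1 - u) ^ (1 - a - 1)) x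
    rw [zero_div, div_self hx.ne', integral_rpow_mul_one_sub_rpow ha (by linarith),
      add_sub_cancel, Real.Gamma_one, div_one] at h
    rw [← h, smul_eq_mul, ← intervalIntegral.integral_const_mul]
    refine intervalIntegral.integral_congr_ae (ae_of_all _ fun t ht => ?_)
    rw [Set.uIoc_of_le hx.le] at ht
    simp only [div_eq_inv_mul, hscale t ht]
    field_simp
  have hd := (intervalIntegrable_sub_rpow_mul_rpow_sub ha ha1 hx).const_mul x
  have hpt : ∀ t ∈ Set.Ioo 0 x,
      x * ((x - t) ^ (-a - 1) * (t ^ (a - 1) - x ^ (a - 1))) - (x - t) ^ (-a) * t ^ (a - 1) =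
        (x - t) ^ (-a - 1) * (t ^ a - x ^ a) := fun t ht => by
    have hs : 0 < x - t := sub_pos.2 ht.2
    rw [Real.rpow_sub_one hs.ne', Real.rpow_sub_one ht.1.ne', Real.rpow_sub_one hx.ne']
    have := ht.1.ne'
    field_simp
    ring
  constructor
  · rw [intervalIntegrable_iff_integrableOn_Ioo_of_le hx.le]
    exact ((intervalIntegrable_iff_integrableOn_Ioo_of_le hx.le).1 (hd.sub hbi)).congr_fun hpt
      measurableSet_Ioo
  · rw [intervalIntegral.integral_of_le hx.le, integral_Ioc_eq_integral_Ioo,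
      ← setIntegral_congr_fun measurableSet_Ioo hpt, ← integral_Ioc_eq_integral_Ioo,
      ← intervalIntegral.integral_of_le hx.le, intervalIntegral.integral_sub hd hbi,
      intervalIntegral.integral_const_mul, integral_sub_rpow_mul_rpow_sub ha ha1 hx, hbv]
    field_simp

lemma integrableOn_sub_div_sub {ψ : ℝ → ℝ} (hlip : LocLip01 ψ)
    (hψ : IntegrableOn ψ (Set.Ioo 0 1)) {x : ℝ} (hx : x ∈ Set.Ioo (0 : ℝ) 1) :
    IntegrableOn (fun s => (ψ s - ψ x) / (x - s)) (Set.Ioo 0 x) := by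
  have hx0 := hx.1
  have hsub : Set.Ioo 0 x ⊆ Set.Ioo 0 1 := Set.Ioo_subset_Ioo_right hx.2.le
  obtain ⟨K, hK⟩ := hlip (x / 2) x (by linarith) (by linarith) hx.2
  have h1 : IntegrableOn (fun s => 2 / x * ‖ψ s - ψ x‖ + |K|) (Set.Ioo 0 x) :=
    (((hψ.mono_set hsub).sub (integrableOn_const (by simp))).norm.const_mul _).add
      (integrableOn_const (by simp))
  refine h1.mono' ?_ (ae_restrict_of_forall_mem measurableSet_Ioo fun s hs => ?_)
  · refine ContinuousOn.aestronglyMeasurable ?_ measurableSet_Ioo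
    exact ((hlip.continuousOn.mono hsub).sub continuousOn_const).div (by fun_prop)
      fun s hs => (sub_pos.2 hs.2).ne'
  · have hpos : 0 < x - s := sub_pos.2 hs.2
    rw [norm_div, Real.norm_of_nonneg hpos.le, div_le_iff₀ hpos]
    rcases le_total s (x / 2) with h | h
    · have h2 : 1 ≤ 2 / x * (x - s) := by
        rw [div_mul_eq_mul_div, le_div_iff₀ hx0]; linarith
      nlinarith [mul_le_mul_of_nonneg_right h2 (norm_nonneg (ψ s - ψ x)),
        mul_nonneg (abs_nonneg K) hpos.le]
    · have h2 := hK s ⟨h, hs.2.le⟩ x ⟨by linarith, le_rfl⟩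
      rw [abs_sub_comm s x, abs_of_pos hpos] at h2
      have h3 : 0 ≤ 2 / x * ‖ψ s - ψ x‖ * (x - s) := by positivity
      rw [Real.norm_eq_abs] at h3 ⊢
      nlinarith [mul_le_mul_of_nonneg_right (le_abs_self K) hpos.le]

lemma marchaud_integral_sub_rpow_mul {ψ : ℝ → ℝ} {a γ x : ℝ} (ha : 0 < a) (ha1 : a < 1)
    (hγ : 0 ≤ γ) (hγ1 : γ < 1) (hlip : LocLip01 ψ) (hψ : IntegrableOn ψ (Set.Ioo 0 1))
    (hO : ψ =O[nhdsWithin 0 (Set.Ioi 0)] fun t : ℝ => t ^ (-γ)) (hx : x ∈ Set.Ioo (0 : ℝ) 1) :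
    ∫ t in (0 : ℝ)..x, (x - t) ^ (-a - 1) * ((∫ s in (0 : ℝ)..t, (t - s) ^ (a - 1) * ψ s) -
        ∫ s in (0 : ℝ)..x, (x - s) ^ (a - 1) * ψ s) =
      (∫ s in (0 : ℝ)..x, (x - s) ^ (a - 1) * ψ s) * x ^ (-a) / a -
        ψ x * (Real.Gamma a * Real.Gamma (1 - a)) / a := by
  have hx0 := hx.1
  have hsub : Set.Ioo 0 x ⊆ Set.Ioo 0 1 := Set.Ioo_subset_Ioo_right hx.2.le
  have hF : ∀ t ∈ Set.Ioc 0 x, IntervalIntegrable (fun s => (t - s) ^ (a - 1) * ψ s)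
      volume 0 t := fun t ht => intervalIntegrable_sub_rpow_mul ha hγ hγ1 hlip.continuousOn hO
    ⟨ht.1, ht.2.trans_lt hx.2⟩
  have hP : ∀ t : ℝ, IntervalIntegrable (fun s => (t - s) ^ (a - 1)) volume 0 t := fun t => by
    have h := ((intervalIntegral.intervalIntegrable_rpow' (a := 0) (b := t)
      (show -1 < a - 1 by linarith)).comp_sub_left t).symm
    simpa using h
  have hPv : ∀ t : ℝ, ∫ s in (0 : ℝ)..t, (t - s) ^ (a - 1) = t ^ a / a := fun t => by
    rw [intervalIntegral.integral_comp_sub_left (fun u : ℝ => u ^ (a - 1)), sub_self, sub_zero,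
      integral_rpow (Or.inl (by linarith)), sub_add_cancel, Real.zero_rpow ha.ne', sub_zero]
  have hφi : ∀ t ∈ Set.Ioc 0 x,
      IntervalIntegrable (fun s => (t - s) ^ (a - 1) * (ψ s - ψ x)) volume 0 t := fun t ht => by
    simpa only [mul_sub] using (hF t ht).sub ((hP t).mul_const (ψ x))
  have hf : ∀ t ∈ Set.Ioc 0 x, ∫ s in (0 : ℝ)..t, (t - s) ^ (a - 1) * ψ s =
      (∫ s in Set.Ioo 0 t, (t - s) ^ (a - 1) * (ψ s - ψ x)) + ψ x / a * t ^ a := fun t ht => by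
    rw [← integral_Ioc_eq_integral_Ioo, ← intervalIntegral.integral_of_le ht.1.le]
    simp only [mul_sub]
    rw [intervalIntegral.integral_sub (hF t ht) ((hP t).mul_const (ψ x)),
      intervalIntegral.integral_mul_const, hPv]
    ring
  obtain ⟨hi, hv⟩ := integral_marchaud_of_integrable (φ := fun s => ψ s - ψ x) ha ha1 hx0
    (((hlip.continuousOn.mono hsub).sub continuousOn_const).aestronglyMeasurable
      measurableSet_Ioo) (integrableOn_sub_div_sub hlip hψ hx)
    fun t ht => (intervalIntegrable_iff_integrableOn_Ioo_of_le ht.1.le).1 (hφi t ht)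
  obtain ⟨ci, cv⟩ := integral_marchaud_rpow ha ha1 hx0
  rw [intervalIntegrable_iff_integrableOn_Ioo_of_le hx0.le] at ci
  rw [intervalIntegral.integral_of_le hx0.le, integral_Ioc_eq_integral_Ioo] at cv
  have hx' := hf x ⟨hx0, le_rfl⟩
  have hpt : ∀ t ∈ Set.Ioo 0 x,
      (x - t) ^ (-a - 1) * ((∫ s in (0 : ℝ)..t, (t - s) ^ (a - 1) * ψ s) -
        ∫ s in (0 : ℝ)..x, (x - s) ^ (a - 1) * ψ s) =
      (x - t) ^ (-a - 1) * ((∫ s in Set.Ioo 0 t, (t - s) ^ (a - 1) * (ψ s - ψ x)) -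
        ∫ s in Set.Ioo 0 x, (x - s) ^ (a - 1) * (ψ s - ψ x)) +
      ψ x / a * ((x - t) ^ (-a - 1) * (t ^ a - x ^ a)) := fun t ht => by
    rw [hf t ⟨ht.1, ht.2.le⟩, hx']
    ring
  rw [intervalIntegral.integral_of_le hx0.le, integral_Ioc_eq_integral_Ioo,
    setIntegral_congr_fun measurableSet_Ioo hpt, integral_add hi (ci.const_mul _),
    integral_const_mul, cv, hv, hx']
  have e : x ^ a * x ^ (-a) = 1 := by rw [← Real.rpow_add hx0]; simp
  linear_combination (-(ψ x / a ^ 2)) * e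

lemma marchaud_jfrac {ψ : ℝ → ℝ} {a γ x : ℝ} (ha : 0 < a) (ha1 : a < 1)
    (hγ : 0 ≤ γ) (hγ1 : γ < 1) (hlip : LocLip01 ψ) (hψ : IntegrableOn ψ (Set.Ioo 0 1))
    (hO : ψ =O[nhdsWithin 0 (Set.Ioi 0)] fun t : ℝ => t ^ (-γ)) (hx : x ∈ Set.Ioo (0 : ℝ) 1) :
    (2 : ℝ) ^ a / Real.Gamma (-a) *
      ((∫ t in (0 : ℝ)..x, (x - t) ^ (-a - 1) * (Jfrac a ψ t - Jfrac a ψ x)) -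
        Jfrac a ψ x * (x ^ (-a) / a)) = ψ x := by
  have h := marchaud_integral_sub_rpow_mul ha ha1 hγ hγ1 hlip hψ hO hx
  simp only [Jfrac]
  simp only [← mul_sub, mul_left_comm _ (1 / ((2 : ℝ) ^ a * Real.Gamma a)) _]
  rw [intervalIntegral.integral_const_mul, h]
  have hΓ : Real.Gamma (1 - a) = -a * Real.Gamma (-a) := by
    rw [← Real.Gamma_add_one (neg_ne_zero.2 ha.ne')]; congr 1; ring
  have h1 : Real.Gamma (1 - a) ≠ 0 := (Real.Gamma_pos_of_pos (by linarith)).ne'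
  have h2 : Real.Gamma (-a) ≠ 0 := fun h0 => h1 (by rw [hΓ, h0, mul_zero])
  have h3 : Real.Gamma a ≠ 0 := (Real.Gamma_pos_of_pos ha).ne'
  have h4 : (2 : ℝ) ^ a ≠ 0 := (Real.rpow_pos_of_pos two_pos _).ne'
  rw [hΓ]
  field_simp
  ring

/-- Let `α > 0` be non-integer with `⌊α⌋ = 2p` even, `α' = α - 2p`, and let `ψ` be locally
Lipschitz on `(0,1)` in `L¹_{1-α'}((0,1))`. Then `y = J_{2p}(J_{α'}(ψ))` satisfies the
Dirichlet-type boundary conditions, `y^{(2p)} = J_{α'}(ψ)` on `(0,1)`, and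
`D_{α'}(y^{(2p)}) = ψ` on `(0,1)`; hence `D_α(y) = ψ`. -/
theorem fractional_ode_dirichlet (α : ℝ) (p : ℕ) (hp : 1 ≤ p)
    (hfloor : ⌊α⌋ = 2 * (p : ℤ)) (hnotint : ∀ m : ℤ, α ≠ m)
    (ψ : ℝ → ℝ) (hlip : LocLip01 ψ) (hmem : MemL1Class (α - 2 * p) ψ) :
    (∀ j, j + 1 < p →
      DifferentiableAt ℝ (iteratedDeriv j (Jgreen p (Jfrac (α - 2 * p) ψ))) 0 ∧
      DifferentiableAt ℝ (iteratedDeriv j (Jgreen p (Jfrac (α - 2 * p) ψ))) 1) ∧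
    (∀ j < 2 * p, ∀ x ∈ Set.Ioo (0 : ℝ) 1,
      DifferentiableAt ℝ (iteratedDeriv j (Jgreen p (Jfrac (α - 2 * p) ψ))) x) ∧
    (∀ j < p,
      iteratedDeriv j (Jgreen p (Jfrac (α - 2 * p) ψ)) 0 = 0 ∧
      iteratedDeriv j (Jgreen p (Jfrac (α - 2 * p) ψ)) 1 = 0) ∧
    (∀ x ∈ Set.Ioo (0 : ℝ) 1,
      iteratedDeriv (2 * p) (Jgreen p (Jfrac (α - 2 * p) ψ)) x = Jfrac (α - 2 * p) ψ x) ∧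
    (∀ x ∈ Set.Ioo (0 : ℝ) 1,
      (2 : ℝ) ^ (α - 2 * p) / Real.Gamma (-(α - 2 * p)) *
        ((∫ t in (0 : ℝ)..x, (x - t) ^ (-(α - 2 * p) - 1) *
            (iteratedDeriv (2 * p) (Jgreen p (Jfrac (α - 2 * p) ψ)) t -
              iteratedDeriv (2 * p) (Jgreen p (Jfrac (α - 2 * p) ψ)) x)) -
          iteratedDeriv (2 * p) (Jgreen p (Jfrac (α - 2 * p) ψ)) x *
            (x ^ (-(α - 2 * p)) / (α - 2 * p))) = ψ x) := by
  obtain ⟨n, rfl⟩ := Nat.exists_eq_add_of_le' hp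
  obtain ⟨γ, hγ, hγa, hO, hO'⟩ := hmem
  have ha : 0 < α - 2 * (n + 1 : ℕ) := by
    have h1 := Int.floor_le α
    rw [hfloor] at h1
    have h2 := hnotint (2 * ((n + 1 : ℕ) : ℤ))
    push_cast at h1 h2 ⊢
    exact sub_pos.2 (h1.lt_of_ne h2.symm)
  have ha1 : α - 2 * (n + 1 : ℕ) < 1 := by
    have h1 := Int.lt_floor_add_one α
    rw [hfloor] at h1
    push_cast at h1 ⊢
    linarith
  generalize α - 2 * ((n + 1 : ℕ) : ℝ) = a at *
  have hγ1 : γ < 1 := by linarith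
  have hψc := hlip.continuousOn
  have hψ := integrableOn_Ioo_of_isBigO hγ hγ1 hψc hO hO'
  have hg : IntegrableOn (Jfrac a ψ) (Set.Ioo 0 1) :=
    (integrableOn_integral_sub_rpow_mul ha hψ).const_mul _
  have hc : ContinuousOn (Jfrac a ψ) (Set.Ioo 0 1) :=
    continuousOn_const.mul (continuousOn_integral_sub_rpow_mul ha hγ hγ1 hψc hO)
  have hd : ∀ j, j + 1 < n + 1 → Differentiable ℝ (iteratedDeriv j (Jgreen (n + 1) (Jfrac a ψ))) :=
    fun j hj => (contDiff_jgreen n hg).differentiable_iteratedDeriv j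
      (by exact_mod_cast Nat.lt_of_succ_lt_succ hj)
  refine ⟨fun j hj => ⟨hd j hj 0, hd j hj 1⟩,
    fun j hj x hx => differentiableAt_iteratedDeriv_jgreen n hg hc hj hx,
    fun j hj => iteratedDeriv_jgreen_boundary n hg hj,
    fun x hx => iteratedDeriv_jgreen n hg hc hx, fun x hx => ?_⟩
  rw [iteratedDeriv_jgreen n hg hc hx]
  have hcongr : ∫ t in (0 : ℝ)..x, (x - t) ^ (-a - 1) *
      (iteratedDeriv (2 * (n + 1)) (Jgreen (n + 1) (Jfrac a ψ)) t - Jfrac a ψ x) =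
      ∫ t in (0 : ℝ)..x, (x - t) ^ (-a - 1) * (Jfrac a ψ t - Jfrac a ψ x) := by
    refine intervalIntegral.integral_congr_ae (ae_of_all _ fun t ht => ?_)
    rw [Set.uIoc_of_le hx.1.le] at ht
    rw [iteratedDeriv_jgreen n hg hc ⟨ht.1, ht.2.trans_lt hx.2⟩]
  rw [hcongr]
  exact marchaud_jfrac ha ha1 hγ hγ1 hlip hψ hO hx
end

section
/- Let α ∈ (0,1) and let ψ : ℝ → ℝ be a Lipschitz function with compact support. Define f(x) := (1/(2^α Γ(α))) ∫_{−∞}^{x} (x−u)^{α−1} ψ(u) du. Then f is well defined on ℝ and for every x ∈ ℝ: (2^α/Γ(−α)) ∫_{−∞}^{x} (x−u)^{−α−1} ( f(u) − f(x) ) du = ψ(x); that is, f = J_{α,∞}(ψ) solves the Marchaud fractional differential equation D_{α,∞}(f) = ψ on ℝ. -/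
open MeasureTheory Filter

/-- The Weyl–Liouville fractional primitive on `ℝ`:
`J_{α,∞}(ψ)(x) = (1/(2^α Γ(α))) ∫_{-∞}^x (x-u)^{α-1} ψ(u) du`. -/
noncomputable def JfracInf (α : ℝ) (ψ : ℝ → ℝ) (x : ℝ) : ℝ :=
  1 / ((2 : ℝ) ^ α * Real.Gamma α) * ∫ u in Set.Iio x, (x - u) ^ (α - 1) * ψ u

open Set

/-- The one-sided power `t₊ ^ s`: equal to `t ^ s` for `t > 0` and to `0` for `t ≤ 0`. -/
noncomputable def rpowPos (s : ℝ) : ℝ → ℝ := (Ioi (0 : ℝ)).indicator (fun t => t ^ s)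

lemma rpowPos_of_pos (s : ℝ) {t : ℝ} (ht : 0 < t) : rpowPos s t = t ^ s :=
  indicator_of_mem (mem_Ioi.2 ht) _

lemma rpowPos_of_nonpos (s : ℝ) {t : ℝ} (ht : t ≤ 0) : rpowPos s t = 0 :=
  indicator_of_notMem (by simpa using ht) _

lemma rpowPos_nonneg (s t : ℝ) : 0 ≤ rpowPos s t :=
  indicator_nonneg (fun _ hx => Real.rpow_nonneg (le_of_lt hx) _) t

@[fun_prop]
lemma measurable_rpowPos (s : ℝ) : Measurable (rpowPos s) :=
  (by fun_prop : Measurable fun t : ℝ => t ^ s).indicator measurableSet_Ioi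

lemma indicator_Iio_rpow_sub_mul (s x : ℝ) (φ : ℝ → ℝ) :
    (Iio x).indicator (fun u => (x - u) ^ s * φ u) = fun u => rpowPos s (x - u) * φ u := by
  ext u
  by_cases h : u < x
  · simp [h, rpowPos_of_pos s (sub_pos.2 h)]
  · simp [h, rpowPos_of_nonpos s (sub_nonpos.2 (not_lt.1 h))]

/-- The beta integral, as the convolution of two one-sided powers. -/
lemma integral_rpowPos_mul_rpowPos {α : ℝ} (h0 : 0 < α) (h1 : α < 1) {v x : ℝ} (hvx : v < x) :
    ∫ z, rpowPos (-α) (x - z) * rpowPos (α - 1) (z - v) =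
      Real.Gamma α * Real.Gamma (1 - α) := by
  have hind : (fun z => rpowPos (-α) (x - z) * rpowPos (α - 1) (z - v)) =
      (Ioo v x).indicator (fun z => (z - v) ^ (α - 1) * (x - z) ^ (-α)) := by
    ext z
    by_cases hz : z ∈ Ioo v x
    · rw [indicator_of_mem hz, rpowPos_of_pos _ (sub_pos.2 hz.1),
        rpowPos_of_pos _ (sub_pos.2 hz.2), mul_comm]
    · rw [indicator_of_notMem hz]
      rcases lt_or_ge v z with h | h
      · rw [rpowPos_of_nonpos (-α) (sub_nonpos.2 (not_lt.1 fun h' => hz ⟨h, h'⟩)), zero_mul]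
      · rw [rpowPos_of_nonpos (α - 1) (sub_nonpos.2 h), mul_zero]
  have hshift : ∫ z in v..x, (z - v) ^ (α - 1) * (x - z) ^ (-α) =
      ∫ y in (0 : ℝ)..(x - v), y ^ (α - 1) * ((x - v) - y) ^ (-α) := by
    have := intervalIntegral.integral_comp_sub_right (a := v) (b := x)
      (fun y : ℝ => y ^ (α - 1) * ((x - v) - y) ^ (-α)) v
    simpa using this
  rw [hind, integral_indicator measurableSet_Ioo, ← integral_Ioc_eq_integral_Ioo,
    ← intervalIntegral.integral_of_le hvx.le, hshift]
  have ha : 0 < x - v := sub_pos.2 hvx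
  have hbeta := Complex.betaIntegral_scaled (α : ℂ) ((1 - α : ℝ) : ℂ) ha
  have hreal : ∫ y in (0 : ℝ)..(x - v), (y : ℂ) ^ ((α : ℂ) - 1) *
        (((x - v : ℝ) : ℂ) - y) ^ (((1 - α : ℝ) : ℂ) - 1) =
      ((∫ y in (0 : ℝ)..(x - v), y ^ (α - 1) * ((x - v) - y) ^ (-α) : ℝ) : ℂ) := by
    rw [← intervalIntegral.integral_ofReal]
    refine intervalIntegral.integral_congr fun y hy => ?_
    rw [uIcc_of_le ha.le] at hy
    have h2 : ((1 - α : ℝ) : ℂ) - 1 = ((-α : ℝ) : ℂ) := by push_cast; ring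
    have h3 : (α : ℂ) - 1 = ((α - 1 : ℝ) : ℂ) := by push_cast; ring
    simp only [h2, h3, Complex.ofReal_mul]
    rw [Complex.ofReal_cpow hy.1, Complex.ofReal_cpow (sub_nonneg.2 hy.2),
      Complex.ofReal_sub (x - v) y]
  have hΓ := Complex.Gamma_mul_Gamma_eq_betaIntegral (s := (α : ℂ)) (t := ((1 - α : ℝ) : ℂ))
    (by simpa using h0) (by simpa using h1)
  have hsum : (α : ℂ) + ((1 - α : ℝ) : ℂ) = 1 := by push_cast; ring
  rw [hsum, Complex.Gamma_one, one_mul] at hΓ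
  rw [hreal, hsum, sub_self, Complex.cpow_zero, one_mul, ← hΓ, Complex.Gamma_ofReal,
    Complex.Gamma_ofReal] at hbeta
  exact_mod_cast hbeta

lemma rpowPos_mul_rpowPos_eq_zero (r s : ℝ) {v x : ℝ} (hvx : x ≤ v) (z : ℝ) :
    rpowPos r (x - z) * rpowPos s (z - v) = 0 := by
  rcases le_or_gt x z with h | h
  · rw [rpowPos_of_nonpos r (sub_nonpos.2 h), zero_mul]
  · rw [rpowPos_of_nonpos s (by linarith), mul_zero]

lemma integral_rpowPos_mul_rpowPos_eq_indicator {α : ℝ} (h0 : 0 < α) (h1 : α < 1) (v x : ℝ) :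
    ∫ z, rpowPos (-α) (x - z) * rpowPos (α - 1) (z - v) =
      (Iio x).indicator (fun _ => Real.Gamma α * Real.Gamma (1 - α)) v := by
  rcases lt_or_ge v x with h | h
  · rw [integral_rpowPos_mul_rpowPos h0 h1 h, indicator_of_mem (mem_Iio.2 h)]
  · simp_rw [rpowPos_mul_rpowPos_eq_zero _ _ h]
    simp [h]

lemma integrable_rpowPos_mul_rpowPos {α : ℝ} (h0 : 0 < α) (h1 : α < 1) (v x : ℝ) :
    Integrable fun z => rpowPos (-α) (x - z) * rpowPos (α - 1) (z - v) := by
  rcases lt_or_ge v x with h | h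
  · refine .of_integral_ne_zero ?_
    rw [integral_rpowPos_mul_rpowPos h0 h1 h]
    exact (mul_pos (Real.Gamma_pos_of_pos h0) (Real.Gamma_pos_of_pos (by linarith))).ne'
  · simp_rw [rpowPos_mul_rpowPos_eq_zero _ _ h]
    exact integrable_zero _ _ _

lemma integrable_beta_kernel {α : ℝ} (h0 : 0 < α) (h1 : α < 1) {g : ℝ → ℝ} (hg : Integrable g)
    (x : ℝ) :
    Integrable (Function.uncurry fun z v =>
      rpowPos (-α) (x - z) * rpowPos (α - 1) (z - v) * g v) (volume.prod volume) := by
  have hmeas : AEStronglyMeasurable (Function.uncurry fun z v =>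
      rpowPos (-α) (x - z) * rpowPos (α - 1) (z - v) * g v) (volume.prod volume) := by
    refine AEStronglyMeasurable.mul (Measurable.aestronglyMeasurable ?_)
      hg.aestronglyMeasurable.comp_snd
    fun_prop
  refine (integrable_prod_iff' hmeas).2 ⟨.of_forall fun v =>
    (integrable_rpowPos_mul_rpowPos h0 h1 v x).mul_const (g v), ?_⟩
  have hnorm : ∀ v, ∫ z, ‖Function.uncurry (fun z v =>
      rpowPos (-α) (x - z) * rpowPos (α - 1) (z - v) * g v) (z, v)‖ =
      (Iio x).indicator (fun v => Real.Gamma α * Real.Gamma (1 - α) * ‖g v‖) v := fun v => by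
    simp only [Function.uncurry_apply_pair, norm_mul, Real.norm_of_nonneg (rpowPos_nonneg _ _)]
    rw [integral_mul_const, integral_rpowPos_mul_rpowPos_eq_indicator h0 h1]
    by_cases h : v < x <;> simp [h]
  simp_rw [hnorm]
  exact (hg.norm.const_mul _).indicator measurableSet_Iio

/-- Composing the fractional integrals of orders `1 - α` and `α` gives the ordinary primitive. -/
lemma integral_rpowPos_mul_integral_rpowPos {α : ℝ} (h0 : 0 < α) (h1 : α < 1) {g : ℝ → ℝ}
    (hg : Integrable g) (x : ℝ) :
    Integrable (fun z => rpowPos (-α) (x - z) * ∫ v, rpowPos (α - 1) (z - v) * g v) ∧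
    ∫ z, rpowPos (-α) (x - z) * ∫ v, rpowPos (α - 1) (z - v) * g v =
      Real.Gamma α * Real.Gamma (1 - α) * ∫ v in Iio x, g v := by
  have hint := integrable_beta_kernel h0 h1 hg x
  have hassoc : ∀ z, rpowPos (-α) (x - z) * ∫ v, rpowPos (α - 1) (z - v) * g v =
      ∫ v, rpowPos (-α) (x - z) * rpowPos (α - 1) (z - v) * g v := fun z => by
    simp_rw [mul_assoc, integral_const_mul]
  simp_rw [hassoc]
  refine ⟨hint.integral_prod_left, ?_⟩
  rw [integral_integral_swap hint, ← integral_const_mul, ← integral_indicator measurableSet_Iio]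
  refine integral_congr_ae (.of_forall fun v => ?_)
  simp only [integral_mul_const, integral_rpowPos_mul_rpowPos_eq_indicator h0 h1]
  by_cases h : v < x <;> simp [h]

lemma integral_Iio_rpowPos_sub {α : ℝ} (h0 : 0 < α) {z x : ℝ} (hzx : z < x) :
    ∫ u in Iio z, rpowPos (-α - 1) (x - u) = rpowPos (-α) (x - z) / α := by
  have hx : 0 < x - z := sub_pos.2 hzx
  have hind : (Iio z).indicator (fun u => rpowPos (-α - 1) (x - u)) =
      fun u => (Ioi (x - z)).indicator (fun t => t ^ (-α - 1)) (x - u) := by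
    ext u
    by_cases h : u < z
    · simp [h, rpowPos_of_pos _ (sub_pos.2 (h.trans hzx))]
    · simp [h]
  rw [← integral_indicator measurableSet_Iio, hind, integral_sub_left_eq_self
    (fun t => (Ioi (x - z)).indicator (fun t => t ^ (-α - 1)) t), integral_indicator
    measurableSet_Ioi, integral_Ioi_rpow_of_lt (by linarith) hx, rpowPos_of_pos _ hx,
    sub_add_cancel, neg_div_neg_eq]

lemma integrableOn_Iio_rpowPos_sub {α : ℝ} (h0 : 0 < α) {z x : ℝ} (hzx : z < x) :
    IntegrableOn (fun u => rpowPos (-α - 1) (x - u)) (Iio z) := by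
  refine Integrable.of_integral_ne_zero ?_
  have hx : 0 < x - z := sub_pos.2 hzx
  rw [integral_Iio_rpowPos_sub h0 hzx, rpowPos_of_pos _ hx]
  positivity

/-- Integration by parts for the Marchaud kernel: integrating `(x - u) ^ (-α - 1)` against the
primitive `∫_u^x I` amounts to integrating `(x - z) ^ (-α) / α` against `I`. -/
lemma integral_rpowPos_mul_setIntegral_Ioo {α : ℝ} (h0 : 0 < α) {I : ℝ → ℝ}
    (hI : AEStronglyMeasurable I) {x : ℝ}
    (hint : Integrable fun z => rpowPos (-α) (x - z) * I z) :
    Integrable (fun u => rpowPos (-α - 1) (x - u) * ∫ z in Ioo u x, I z) ∧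
    ∫ u, rpowPos (-α - 1) (x - u) * ∫ z in Ioo u x, I z =
      α⁻¹ * ∫ z, rpowPos (-α) (x - z) * I z := by
  set k : ℝ → ℝ → ℝ := fun u z =>
    {p : ℝ × ℝ | p.1 < p.2 ∧ p.2 < x}.indicator
      (fun p => rpowPos (-α - 1) (x - p.1) * I p.2) (u, z) with hk
  have hset : MeasurableSet {p : ℝ × ℝ | p.1 < p.2 ∧ p.2 < x} :=
    (measurableSet_lt measurable_fst measurable_snd).inter
      (measurableSet_lt measurable_snd measurable_const)
  have hkz : ∀ z, (fun u => k u z) = fun u =>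
      (Iio z).indicator (fun u => rpowPos (-α - 1) (x - u)) u * (Iio x).indicator I z := fun z => by
    ext u
    by_cases h : u < z <;> by_cases h' : z < x <;> simp [hk, h, h']
  have hku : ∀ u, ∫ z, k u z = rpowPos (-α - 1) (x - u) * ∫ z in Ioo u x, I z := fun u => by
    rw [← integral_indicator measurableSet_Ioo, ← integral_const_mul]
    refine integral_congr_ae (.of_forall fun z => ?_)
    by_cases h : u < z <;> by_cases h' : z < x <;> simp [hk, h, h']
  have hkI : ∀ z, (∫ u in Iio z, rpowPos (-α - 1) (x - u)) * (Iio x).indicator I z =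
      α⁻¹ * (rpowPos (-α) (x - z) * I z) := fun z => by
    rcases lt_or_ge z x with h | h
    · rw [integral_Iio_rpowPos_sub h0 h, indicator_of_mem (mem_Iio.2 h)]; ring
    · simp [h, rpowPos_of_nonpos _ (sub_nonpos.2 h)]
  have hkint : Integrable (Function.uncurry k) (volume.prod volume) := by
    have hmeas : AEStronglyMeasurable (Function.uncurry k) (volume.prod volume) := by
      refine AEStronglyMeasurable.indicator (AEStronglyMeasurable.mul
        (Measurable.aestronglyMeasurable (by fun_prop)) hI.comp_snd) hset
    refine (integrable_prod_iff' hmeas).2 ⟨.of_forall fun z => ?_, ?_⟩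
    · change Integrable fun u => k u z
      rw [hkz]
      rcases lt_or_ge z x with h | h
      · exact ((integrable_indicator_iff measurableSet_Iio).2
          (integrableOn_Iio_rpowPos_sub h0 h)).mul_const _
      · simp [h]
    · refine (hint.norm.const_mul α⁻¹).congr (.of_forall fun z => ?_)
      change _ = ∫ u, ‖(fun u => k u z) u‖
      rw [hkz]
      simp only [norm_mul]
      rw [integral_mul_const, ← norm_mul, ← Real.norm_of_nonneg (inv_pos.2 h0).le, ← norm_mul,
        ← hkI, norm_mul]
      congr 1
      rw [← integral_indicator measurableSet_Iio, Real.norm_of_nonneg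
        (integral_nonneg fun u => indicator_nonneg (fun _ _ => rpowPos_nonneg _ _) u)]
      refine integral_congr_ae (.of_forall fun u => ?_)
      exact (Real.norm_of_nonneg (indicator_nonneg (fun _ _ => rpowPos_nonneg _ _) u)).symm
  simp_rw [← hku]
  refine ⟨hkint.integral_prod_left, ?_⟩
  rw [integral_integral_swap hkint, ← integral_const_mul]
  refine integral_congr_ae (.of_forall fun z => ?_)
  simp only [hkz, integral_mul_const, integral_indicator measurableSet_Iio, hkI]

/-- A one-sided power truncated at `R`, the integrable majorant of the Weyl integrands. -/
lemma integrable_indicator_Iic_rpowPos {s : ℝ} (hs : -1 < s) (R : ℝ) :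
    Integrable ((Iic R).indicator (rpowPos s)) := by
  rcases le_total R 0 with hR | hR
  · have : (Iic R).indicator (rpowPos s) = 0 := by
      ext t
      by_cases h : t ≤ R
      · simp [h, rpowPos_of_nonpos s (h.trans hR)]
      · simp [h]
    rw [this]
    exact integrable_zero _ _ _
  · have h := (intervalIntegral.intervalIntegrable_rpow' (a := 0) (b := R) hs).1
    rw [rpowPos, indicator_indicator, inter_comm, Ioi_inter_Iic]
    exact (integrable_indicator_iff measurableSet_Ioc).2 h

lemma norm_rpowPos_mul_le {h : ℝ → ℝ} {C R : ℝ} (hC : ∀ y, ‖h y‖ ≤ C)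
    (hR : ∀ y, y < -R → h y = 0) (s : ℝ) {x z : ℝ} (hzx : z ≤ x) (t : ℝ) :
    ‖rpowPos s t * h (z - t)‖ ≤ (Iic (x + R)).indicator (rpowPos s) t * C := by
  by_cases ht : t ≤ x + R
  · rw [norm_mul, Real.norm_of_nonneg (rpowPos_nonneg _ _), indicator_of_mem (mem_Iic.2 ht)]
    exact mul_le_mul_of_nonneg_left (hC _) (rpowPos_nonneg _ _)
  · rw [hR _ (by linarith), mul_zero, norm_zero, indicator_of_notMem (by simpa using ht), zero_mul]

lemma integrable_rpowPos_mul_comp_sub {h : ℝ → ℝ} (hm : Measurable h) {C R : ℝ}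
    (hC : ∀ y, ‖h y‖ ≤ C) (hR : ∀ y, y < -R → h y = 0) {s : ℝ} (hs : -1 < s) (x : ℝ) :
    Integrable fun t => rpowPos s t * h (x - t) :=
  ((integrable_indicator_Iic_rpowPos hs (x + R)).mul_const C).mono' (by fun_prop)
    (.of_forall fun t => norm_rpowPos_mul_le hC hR s le_rfl t)

lemma integral_rpowPos_sub_mul (s x : ℝ) (h : ℝ → ℝ) :
    ∫ v, rpowPos s (x - v) * h v = ∫ t, rpowPos s t * h (x - t) := by
  simpa using integral_sub_left_eq_self (fun t => rpowPos s t * h (x - t)) volume x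

/-- Fractional integration commutes with taking primitives. -/
lemma integral_rpowPos_sub_integral_rpowPos {ψ g : ℝ → ℝ} (hm : Measurable ψ) (hgm : Measurable g)
    {C R : ℝ} (hψC : ∀ y, ‖ψ y‖ ≤ C) (hC : ∀ y, ‖g y‖ ≤ C) (hψR : ∀ y, y < -R → ψ y = 0)
    (hR : ∀ y, y < -R → g y = 0) (hftc : ∀ a b, ∫ y in a..b, g y = ψ b - ψ a)
    {s : ℝ} (hs : -1 < s) {u x : ℝ} (hux : u < x) :
    (∫ v, rpowPos s (x - v) * ψ v) - ∫ v, rpowPos s (u - v) * ψ v =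
      ∫ z in Ioo u x, ∫ v, rpowPos s (z - v) * g v := by
  simp_rw [integral_rpowPos_sub_mul]
  rw [← integral_sub (integrable_rpowPos_mul_comp_sub hm hψC hψR hs x)
    (integrable_rpowPos_mul_comp_sub hm hψC hψR hs u)]
  have hint : Integrable (Function.uncurry fun z t => rpowPos s t * g (z - t))
      ((volume.restrict (Ioo u x)).prod volume) := by
    refine (((integrable_const (1 : ℝ)).mul_prod
      ((integrable_indicator_Iic_rpowPos hs (x + R)).mul_const C))).mono'
      (Measurable.aestronglyMeasurable (by fun_prop)) ?_
    have hmem : ∀ᵐ p ∂((volume.restrict (Ioo u x)).prod (volume : Measure ℝ)), p.1 ∈ Ioo u x :=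
      Measure.quasiMeasurePreserving_fst.ae (ae_restrict_mem measurableSet_Ioo)
    filter_upwards [hmem] with p hp
    rw [one_mul]
    exact norm_rpowPos_mul_le hC hR s hp.2.le p.2
  rw [integral_integral_swap hint]
  refine integral_congr_ae (.of_forall fun t => ?_)
  simp only
  rw [integral_const_mul, ← integral_Ioc_eq_integral_Ioo, ← intervalIntegral.integral_of_le hux.le,
    intervalIntegral.integral_comp_sub_right g t, hftc, mul_sub]

lemma JfracInf_eq_integral_rpowPos (α : ℝ) (ψ : ℝ → ℝ) (x : ℝ) :
    JfracInf α ψ x = 1 / ((2 : ℝ) ^ α * Real.Gamma α) * ∫ u, rpowPos (α - 1) (x - u) * ψ u := by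
  rw [JfracInf, ← integral_indicator measurableSet_Iio, indicator_Iio_rpow_sub_mul]

lemma setIntegral_Iio_deriv_of_lipschitz {ψ : ℝ → ℝ} {K : NNReal} (hψ : LipschitzWith K ψ)
    {R : ℝ} (hψR : ∀ y, y < -R → ψ y = 0) (hR : ∀ y, y < -R → deriv ψ y = 0) (x : ℝ) :
    ∫ v in Iio x, deriv ψ v = ψ x := by
  have ha : min x (-R) - 1 < -R := by linarith [min_le_right x (-R)]
  have hax : min x (-R) - 1 < x := by linarith [min_le_left x (-R)]
  have hftc := (hψ.lipschitzOnWith (s := uIcc (min x (-R) - 1) x))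
    |>.absolutelyContinuousOnInterval.integral_deriv_eq_sub
  rw [hψR _ ha, sub_zero, intervalIntegral.integral_of_le hax.le] at hftc
  rw [← hftc, ← integral_Iic_eq_integral_Iio]
  refine setIntegral_eq_of_subset_of_forall_sdiff_eq_zero measurableSet_Iic
    Ioc_subset_Iic_self fun v hv => hR v ?_
  have : v ≤ min x (-R) - 1 := not_lt.1 fun h => hv.2 ⟨h, hv.1⟩
  linarith

/-- For `ψ` Lipschitz with compact support, `f = J_{α,∞}(ψ)` is well defined on `ℝ` and
solves the Marchaud fractional differential equation `D_{α,∞}(f) = ψ` on `ℝ`. -/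
theorem marchaud_ode_on_real_line (α : ℝ) (hα : α ∈ Set.Ioo (0 : ℝ) 1) (ψ : ℝ → ℝ)
    (hlip : ∃ K : NNReal, LipschitzWith K ψ) (hsupp : HasCompactSupport ψ) :
    (∀ x : ℝ, IntegrableOn (fun u => (x - u) ^ (α - 1) * ψ u) (Set.Iio x)) ∧
    ∀ x : ℝ,
      IntegrableOn (fun u => (x - u) ^ (-α - 1) * (JfracInf α ψ u - JfracInf α ψ x))
        (Set.Iio x) ∧
      (2 : ℝ) ^ α / Real.Gamma (-α) *
        ∫ u in Set.Iio x, (x - u) ^ (-α - 1) * (JfracInf α ψ u - JfracInf α ψ x) = ψ x := by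
  obtain ⟨h0, h1⟩ := hα
  obtain ⟨K, hK⟩ := hlip
  obtain ⟨M, hM⟩ := hsupp.exists_bound_of_continuous hK.continuous
  obtain ⟨R, hR⟩ := hsupp.isCompact.isBounded.subset_closedBall 0
  have hnot : ∀ y, y < -R → y ∉ tsupport ψ := fun y hy hmem => by
    have := hR hmem
    rw [mem_closedBall_zero_iff, Real.norm_eq_abs] at this
    linarith [neg_abs_le y]
  have hψR : ∀ y, y < -R → ψ y = 0 := fun y hy => image_eq_zero_of_notMem_tsupport (hnot y hy)
  have hgR : ∀ y, y < -R → deriv ψ y = 0 := fun y hy => deriv_of_notMem_tsupport (hnot y hy)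
  have hm : Measurable ψ := hK.continuous.measurable
  have hgm : Measurable (deriv ψ) := measurable_deriv ψ
  have hgK : ∀ y, ‖deriv ψ y‖ ≤ K := fun y => norm_deriv_le_of_lipschitz hK
  have hs : -1 < α - 1 := by linarith
  have hgint : Integrable (deriv ψ) := by
    refine (integrableOn_iff_integrable_of_support_subset
      (support_deriv_subset (f := ψ))).1 ?_
    exact Measure.integrableOn_of_bounded hsupp.isCompact.measure_lt_top.ne
      hgm.aestronglyMeasurable (.of_forall hgK)
  refine ⟨fun x => ?_, fun x => ?_⟩
  · rw [← integrable_indicator_iff measurableSet_Iio, indicator_Iio_rpow_sub_mul]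
    have := (integrable_rpowPos_mul_comp_sub hm hM hψR hs x).comp_sub_left x
    simpa using this
  set I : ℝ → ℝ := fun z => ∫ v, rpowPos (α - 1) (z - v) * deriv ψ v
  have hImeas : AEStronglyMeasurable I :=
    (StronglyMeasurable.integral_prod_right (f := fun z v => rpowPos (α - 1) (z - v) * deriv ψ v)
      (Measurable.stronglyMeasurable (by fun_prop))).aestronglyMeasurable
  obtain ⟨hint, hval⟩ := integral_rpowPos_mul_integral_rpowPos h0 h1 hgint x
  obtain ⟨hint', hval'⟩ := integral_rpowPos_mul_setIntegral_Ioo h0 hImeas hint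
  rw [hval, setIntegral_Iio_deriv_of_lipschitz hK hψR hgR] at hval'
  set c : ℝ := 1 / ((2 : ℝ) ^ α * Real.Gamma α) with hc
  have hdiff : ∀ u, rpowPos (-α - 1) (x - u) * (JfracInf α ψ u - JfracInf α ψ x) =
      -c * (rpowPos (-α - 1) (x - u) * ∫ z in Ioo u x, I z) := fun u => by
    rcases lt_or_ge u x with h | h
    · rw [← integral_rpowPos_sub_integral_rpowPos hm hgm (C := max M K)
        (fun y => (hM y).trans (le_max_left _ _)) (fun y => (hgK y).trans (le_max_right _ _))
        hψR hgR (fun a b => hK.lipschitzOnWith.absolutelyContinuousOnInterval.integral_deriv_eq_sub)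
        hs h, JfracInf_eq_integral_rpowPos, JfracInf_eq_integral_rpowPos]
      ring
    · simp [rpowPos_of_nonpos _ (sub_nonpos.2 h)]
  rw [← integrable_indicator_iff measurableSet_Iio, ← integral_indicator measurableSet_Iio,
    indicator_Iio_rpow_sub_mul]
  simp_rw [hdiff]
  refine ⟨hint'.const_mul _, ?_⟩
  rw [integral_const_mul, hval']
  have hΓ : Real.Gamma (1 - α) = -α * Real.Gamma (-α) := by
    rw [← Real.Gamma_add_one (neg_ne_zero.2 h0.ne'), neg_add_eq_sub]
  have hΓpos := Real.Gamma_pos_of_pos h0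
  have hΓ' : Real.Gamma (-α) ≠ 0 := fun h => by
    rw [h, mul_zero] at hΓ
    exact (Real.Gamma_pos_of_pos (sub_pos.2 h1)).ne' hΓ
  have h2 : (2 : ℝ) ^ α ≠ 0 := by positivity
  rw [hΓ, hc]
  field_simp
end
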